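/- arXiv:2402.01561 — 3 statements merged into one kernel-verified Lean document; each statement's English description precedes it below -/
import Mathlib

section
/- Let b ∈ [7/16,1/2), σ ∈ (1/2,2/3), s ≥ 0, β ∈ ℝ, and fix a cutoff ψ as in the context. Then there is a constant C > 0 such that for all Schwartz functions v₁, v₂ : ℝ² → ℂ one has ‖(t,x) ↦ ψ(t)·∂_x(v₁(t,x)v₂(t,x))‖_{Y^{s,b,β,σ}} ≤ C ‖v₁‖_{X^{s,b,β,σ}} ‖v₂‖_{X^{s,b,β,σ}}. -/
open MeasureTheory

/-- Two-dimensional Fourier transform: `F̂(τ,ξ) = ∬ e^{-i(tτ+xξ)} F(t,x) dt dx`. -/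
noncomputable def FT2 (F : ℝ × ℝ → ℂ) (τ ξ : ℝ) : ℂ :=
  ∫ q : ℝ × ℝ, Complex.exp (-(Complex.I * (q.1 * τ + q.2 * ξ))) * F q

/-- The weight `ν(τ,ξ) = (1+|τ-ξ³+βξ|)^b + χ_{[-1,1]}(ξ)(1+|τ|)^σ`. -/
noncomputable def nuWt (b σ β τ ξ : ℝ) : ℝ :=
  (1 + |τ - ξ^3 + β * ξ|) ^ b +
    Set.indicator (Set.Icc (-1:ℝ) 1) (fun _ => (1:ℝ)) ξ * (1 + |τ|) ^ σ

/-- The weight `γ(τ,ξ) = (1+|τ-ξ³+βξ|)^{-b} + χ_{[-1,1]}(ξ)(1+|τ|)^{σ-1}`. -/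
noncomputable def gaWt (b σ β τ ξ : ℝ) : ℝ :=
  (1 + |τ - ξ^3 + β * ξ|) ^ (-b) +
    Set.indicator (Set.Icc (-1:ℝ) 1) (fun _ => (1:ℝ)) ξ * (1 + |τ|) ^ (σ - 1)

/-- The Bourgain norm `‖F‖_{X^{s,b,β,σ}}`, where `F = F(t,x)`. -/
noncomputable def XNorm (s b β σ : ℝ) (F : ℝ × ℝ → ℂ) : ℝ :=
  Real.sqrt (∫ q : ℝ × ℝ,
    (1 + |q.2| + |q.1| ^ ((1:ℝ)/3)) ^ (2 * s) * (nuWt b σ β q.1 q.2)^2 * ‖FT2 F q.1 q.2‖^2)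

/-- The Bourgain norm `‖F‖_{Y^{s,b,β,σ}}`, where `F = F(t,x)`. -/
noncomputable def YNorm (s b β σ : ℝ) (F : ℝ × ℝ → ℂ) : ℝ :=
  Real.sqrt (∫ q : ℝ × ℝ,
    (1 + |q.2| + |q.1| ^ ((1:ℝ)/3)) ^ (2 * s) * (gaWt b σ β q.1 q.2)^2 * ‖FT2 F q.1 q.2‖^2)

section

open MeasureTheory

lemma ptA {x y a b r : ℝ} (hx : 1 ≤ x) (hy : 1 ≤ y) (ha : 0 ≤ a) (hb : 0 ≤ b) (h : r ≤ a + b) :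
    x ^ (-a) * y ^ (-b) ≤ x ^ (-r) + y ^ (-r) := by
  have hx0 : 0 < x := by linarith
  have hy0 : 0 < y := by linarith
  rcases le_total x y with hxy | hxy
  · have h1 : y ^ (-b) ≤ x ^ (-b) := Real.rpow_le_rpow_of_nonpos hx0 hxy (by linarith)
    have h2 : x ^ (-a) * y ^ (-b) ≤ x ^ (-a) * x ^ (-b) := by gcongr
    rw [← Real.rpow_add hx0] at h2
    have h3 : x ^ (-a + -b) ≤ x ^ (-r) := Real.rpow_le_rpow_of_exponent_le hx (by linarith)
    have := Real.rpow_nonneg hy0.le (-r)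
    linarith
  · have h1 : x ^ (-a) ≤ y ^ (-a) := Real.rpow_le_rpow_of_nonpos hy0 hxy (by linarith)
    have h2 : x ^ (-a) * y ^ (-b) ≤ y ^ (-a) * y ^ (-b) := by gcongr
    rw [← Real.rpow_add hy0] at h2
    have h3 : y ^ (-a + -b) ≤ y ^ (-r) := Real.rpow_le_rpow_of_exponent_le hy (by linarith)
    have := Real.rpow_nonneg hx0.le (-r)
    linarith

lemma ptB {x y a r : ℝ} (hy : 1 ≤ y) (hyx : y ≤ x) (h : a ≤ r) :
    y ^ (-a) ≤ x ^ (r - a) * y ^ (-r) := by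
  have hy0 : 0 < y := by linarith
  have : y ^ (-a) = y ^ (r - a) * y ^ (-r) := by rw [← Real.rpow_add hy0]; congr 1; ring
  rw [this]
  have := Real.rpow_le_rpow hy0.le hyx (show 0 ≤ r - a by linarith)
  gcongr

/-- three-factor bound -/
lemma ptC {x y z e a b r f : ℝ} (hy : 1 ≤ y) (hyx : y ≤ x) (hz : 1 ≤ z) (hzx : z ≤ x)
    (ha : a ≤ r) (hb : b ≤ r) (hf : f ≤ e - (r - a) - (r - b)) :
    x ^ (-e) * (y ^ (-a) * z ^ (-b)) ≤ x ^ (-f) * (y ^ (-r) * z ^ (-r)) := by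
  have hx : 1 ≤ x := hy.trans hyx
  have hx0 : 0 < x := by linarith
  have h1 := ptB hy hyx ha
  have h2 := ptB hz hzx hb
  have hy0 := Real.rpow_nonneg (show 0 ≤ y by linarith) (-a)
  have hz0 := Real.rpow_nonneg (show 0 ≤ z by linarith) (-b)
  have hy1 := Real.rpow_nonneg (show 0 ≤ y by linarith) (-r)
  have hz1 := Real.rpow_nonneg (show 0 ≤ z by linarith) (-r)
  calc x ^ (-e) * (y ^ (-a) * z ^ (-b))
      ≤ x ^ (-e) * ((x ^ (r - a) * y ^ (-r)) * (x ^ (r - b) * z ^ (-r))) := by gcongr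
    _ = (x ^ (-e) * x ^ (r - a) * x ^ (r - b)) * (y ^ (-r) * z ^ (-r)) := by ring
    _ = x ^ (-e + (r - a) + (r - b)) * (y ^ (-r) * z ^ (-r)) := by
        rw [← Real.rpow_add hx0, ← Real.rpow_add hx0]
    _ ≤ _ := by
        gcongr
        linarith

lemma pt_sq {u x : ℝ} (hx : 1 ≤ x) (h : u ^ 2 ≤ 2 * x) : u ^ 2 * x ^ (-(1/2 : ℝ)) ≤ 2 * |u| := by
  have hx0 : 0 < x := by linarith
  have h1 : |u| ≤ 2 * x ^ (1/2 : ℝ) := by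
    rw [← Real.sqrt_eq_rpow]
    refine abs_le_of_sq_le_sq ?_ (by positivity)
    rw [mul_pow, Real.sq_sqrt hx0.le]; linarith
  rw [Real.rpow_neg hx0.le, ← div_eq_mul_inv, div_le_iff₀ (by positivity), ← sq_abs]
  nlinarith [abs_nonneg u]

lemma pt_cube {u x : ℝ} (hx : 1 ≤ x) (h : |u| ^ 3 ≤ 8 * x) : u ^ 2 * x ^ (-(7/8 : ℝ)) ≤ 4 := by
  have hx0 : 0 < x := by linarith
  have h1 : |u| ≤ 2 * x ^ (1/3 : ℝ) := by
    apply le_of_pow_le_pow_left₀ (n := 3) (by norm_num) (by positivity)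
    rw [mul_pow, ← Real.rpow_natCast (x ^ (1/3 : ℝ)), ← Real.rpow_mul hx0.le]
    norm_num; linarith
  have h2 : u ^ 2 ≤ 4 * x ^ (2/3 : ℝ) := by
    have : x ^ (2/3 : ℝ) = (x ^ (1/3 : ℝ)) ^ 2 := by
      rw [← Real.rpow_natCast (x ^ (1/3 : ℝ)), ← Real.rpow_mul hx0.le]; norm_num
    rw [this, ← sq_abs]
    nlinarith [abs_nonneg u]
  have h3 : x ^ (2/3 : ℝ) ≤ x ^ (7/8 : ℝ) := Real.rpow_le_rpow_of_exponent_le hx (by norm_num)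
  rw [Real.rpow_neg hx0.le, ← div_eq_mul_inv, div_le_iff₀ (by positivity)]
  linarith

lemma pt_fin {C k J I : ℝ} (hC : 0 ≤ C) (hk : k ≤ 4) (hJ : 0 ≤ J) (hI : 0 ≤ I) :
    C * (k * J) ≤ 4 * C * (J + I) := by
  have h1 : k * J ≤ 4 * J := by gcongr
  have h2 : C * (k * J) ≤ C * (4 * (J + I)) := by gcongr; linarith
  linarith

lemma pt_aux1 {a b x : ℝ} (ha : 0 ≤ a) (h : a ≤ 2 * b) (h2 : a * b ≤ x) : a ^ 2 ≤ 2 * x := by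
  nlinarith

lemma pt_aux2 {a b c : ℝ} (hb : 1 < b) (hc : 1 < c) (h2 : 2 * a ≤ b + c) : a ≤ b * c := by
  nlinarith

lemma pt_aux3 {a b c x : ℝ} (ha : 0 ≤ a) (h1 : a ≤ b) (h2 : a ≤ 2 * c) (h : a * (b * c) ≤ x) :
    a ^ 3 ≤ 8 * x := by
  have h3 : a * a ≤ b * (2 * c) := by gcongr; linarith
  have h4 : a * (a * a) ≤ a * (b * (2 * c)) := by gcongr
  nlinarith

lemma pt_aux4 {u1 u2 : ℝ} (h1 : 1 < |u1|) (h2 : 1 < |u2|) : |u1 + u2| ≤ 2 * |u1 * u2| := by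
  rw [abs_mul]; have := abs_add_le u1 u2; nlinarith

lemma pt_aux5 {u1 u2 : ℝ} (h1 : 1 < |u1|) (h2 : 1 < |u2|) (h : |u1 - u2| ≤ 1) :
    (u1 + u2) ^ 2 ≤ 8 * |u1 * u2| := by
  have e : 4 * (u1 * u2) = (u1 + u2) ^ 2 - (u1 - u2) ^ 2 := by ring
  have hs : (u1 - u2) ^ 2 ≤ 1 := by rw [← sq_abs]; nlinarith [abs_nonneg (u1 - u2)]
  have : 1 < |u1 * u2| := by rw [abs_mul]; nlinarith
  have := le_abs_self (u1 * u2)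
  linarith

set_option maxHeartbeats 800000 in
/-- c0 -/
lemma pt_c0 {r C x0 x1 x2 u1 u2 G N1 N2 : ℝ} (hr1 : 1 < r) (hr2 : r ≤ 17/16) (hC : 1 ≤ C)
    (h0 : 1 ≤ x0) (h1 : 1 ≤ x1) (h2 : 1 ≤ x2) (h10 : x1 ≤ x0) (h20 : x2 ≤ x0)
    (hres : |(u1 + u2) * u1 * u2| ≤ x0) (hu1 : 1 < |u1|) (hu2 : 1 < |u2|)
    (hG : 0 ≤ G) (hN1 : 0 ≤ N1) (hN2 : 0 ≤ N2)
    (hGl : G ≤ C * x0 ^ (-(2/3 : ℝ))) (hGh : 1 < |u1 + u2| → G ≤ C * x0 ^ (-(7/8 : ℝ)))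
    (hN1h : N1 ≤ x1 ^ (-(7/8 : ℝ))) (hN2h : N2 ≤ x2 ^ (-(7/8 : ℝ))) :
    (u1 + u2) ^ 2 * (G * (N1 * N2)) ≤ 4 * C * (|u1 + u2| * |u1 - u2| * (x1 ^ (-r) * x2 ^ (-r)) +
      (if |u1 - u2| ≤ 1 then x1 ^ (-r) + x2 ^ (-r) else 0)) := by
  set u := u1 + u2 with hu
  have k1 : 0 ≤ x1 ^ (-r) := by positivity
  have k2 : 0 ≤ x2 ^ (-r) := by positivity
  have hN : N1 * N2 ≤ x1 ^ (-(7/8 : ℝ)) * x2 ^ (-(7/8 : ℝ)) := by gcongr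
  have hNN : 0 ≤ N1 * N2 := by positivity
  have ite0 : 0 ≤ (if |u1 - u2| ≤ 1 then x1 ^ (-r) + x2 ^ (-r) else 0) := by split_ifs <;> positivity
  have jac0 : 0 ≤ |u| * |u1 - u2| * (x1 ^ (-r) * x2 ^ (-r)) := by positivity
  have hmul : |u| ≤ 2 * |u1 * u2| := pt_aux4 hu1 hu2
  rcases le_or_gt |u| 1 with hlow | hhigh
  · have hD : |u| ≤ |u1 - u2| := by
      have e : 2 * u1 = u + (u1 - u2) := by rw [hu]; ring
      have := abs_add_le u (u1 - u2)
      rw [← e, abs_mul] at this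
      norm_num at this; linarith
    have hD2 : u ^ 2 ≤ |u| * |u1 - u2| := by rw [← sq_abs]; nlinarith [abs_nonneg u]
    have hk := ptC (e := 2/3) (a := 7/8) (b := 7/8) (r := r) (f := 0) h1 h10 h2 h20
      (by linarith) (by linarith) (by linarith)
    rw [neg_zero, Real.rpow_zero, one_mul] at hk
    have : u ^ 2 * (G * (N1 * N2)) ≤ C * (|u| * |u1 - u2| * (x1 ^ (-r) * x2 ^ (-r))) := by
      calc u ^ 2 * (G * (N1 * N2)) ≤ u ^ 2 * (C * x0 ^ (-(2/3 : ℝ)) * (x1 ^ (-(7/8 : ℝ)) * x2 ^ (-(7/8 : ℝ)))) := by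
            gcongr
        _ = C * (u ^ 2 * (x0 ^ (-(2/3 : ℝ)) * (x1 ^ (-(7/8 : ℝ)) * x2 ^ (-(7/8 : ℝ))))) := by ring
        _ ≤ _ := by gcongr
    have h9 := pt_fin (C := C) (k := 1) (by linarith) (by norm_num) jac0 ite0
    rw [one_mul] at h9
    exact this.trans h9
  · have hGN : u ^ 2 * (G * (N1 * N2)) ≤ u ^ 2 * (C * x0 ^ (-(7/8 : ℝ)) * (x1 ^ (-(7/8 : ℝ)) * x2 ^ (-(7/8 : ℝ)))) := by
      have := hGh hhigh
      gcongr
    rcases le_or_gt |u1 - u2| 1 with hD | hD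
    · rw [if_pos hD]
      have hc : |u| ^ 3 ≤ 8 * x0 := by
        have : u ^ 2 ≤ 8 * |u1 * u2| := pt_aux5 hu1 hu2 hD
        rw [mul_assoc, abs_mul] at hres
        rw [pow_succ, sq_abs]
        nlinarith [abs_nonneg u]
      have h3 := pt_cube h0 hc
      have h4 := ptA (r := r) h1 h2 (show (0:ℝ) ≤ 7/8 by norm_num) (show (0:ℝ) ≤ 7/8 by norm_num) (by linarith)
      calc u ^ 2 * (G * (N1 * N2)) ≤ _ := hGN
        _ = C * ((u ^ 2 * x0 ^ (-(7/8 : ℝ))) * (x1 ^ (-(7/8 : ℝ)) * x2 ^ (-(7/8 : ℝ)))) := by ring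
        _ ≤ C * (4 * (x1 ^ (-r) + x2 ^ (-r))) := by gcongr
        _ ≤ 4 * C * ((x1 ^ (-r) + x2 ^ (-r)) + |u| * |u1 - u2| * (x1 ^ (-r) * x2 ^ (-r))) :=
            pt_fin (by linarith) (by norm_num) (by positivity) jac0
        _ = _ := by ring
    · have hk := ptC (e := 7/8) (a := 7/8) (b := 7/8) (r := r) (f := 1/2) h1 h10 h2 h20
        (by linarith) (by linarith) (by linarith)
      have hsq : u ^ 2 ≤ 2 * x0 := by
        rw [mul_assoc, abs_mul] at hres
        rw [← sq_abs]
        exact pt_aux1 (abs_nonneg u) hmul hres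
      have h3 := pt_sq h0 hsq
      calc u ^ 2 * (G * (N1 * N2)) ≤ _ := hGN
        _ = C * (u ^ 2 * (x0 ^ (-(7/8 : ℝ)) * (x1 ^ (-(7/8 : ℝ)) * x2 ^ (-(7/8 : ℝ))))) := by ring
        _ ≤ C * (u ^ 2 * (x0 ^ (-(1/2 : ℝ)) * (x1 ^ (-r) * x2 ^ (-r)))) := by gcongr
        _ = C * ((u ^ 2 * x0 ^ (-(1/2 : ℝ))) * (x1 ^ (-r) * x2 ^ (-r))) := by ring
        _ ≤ C * ((2 * |u|) * (x1 ^ (-r) * x2 ^ (-r))) := by gcongr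
        _ ≤ C * ((2 * (|u| * |u1 - u2|)) * (x1 ^ (-r) * x2 ^ (-r))) := by
            gcongr
            nlinarith [abs_nonneg u]
        _ = C * (2 * (|u| * |u1 - u2| * (x1 ^ (-r) * x2 ^ (-r)))) := by ring
        _ ≤ _ := pt_fin (by linarith) (by norm_num) jac0 ite0

set_option maxHeartbeats 800000 in
/-- c1 -/
lemma pt_c1 {r C x0 x1 x2 u1 u2 G N1 N2 : ℝ} (hr1 : 1 < r) (hr2 : r ≤ 17/16) (hC : 1 ≤ C)
    (h0 : 1 ≤ x0) (h1 : 1 ≤ x1) (h2 : 1 ≤ x2) (h01 : x0 ≤ x1) (h21 : x2 ≤ x1)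
    (hres : |(u1 + u2) * u1 * u2| ≤ x1) (hu1 : 1 < |u1|) (hu2 : 1 < |u2|)
    (hG : 0 ≤ G) (hN1 : 0 ≤ N1) (hN2 : 0 ≤ N2)
    (hGl : G ≤ C * x0 ^ (-(2/3 : ℝ))) (hGh : 1 < |u1 + u2| → G ≤ C * x0 ^ (-(7/8 : ℝ)))
    (hN1h : N1 ≤ x1 ^ (-(7/8 : ℝ))) (hN2h : N2 ≤ x2 ^ (-(7/8 : ℝ))) :
    (u1 + u2) ^ 2 * (G * (N1 * N2)) ≤ 4 * C * (|u1| * |u1 + 2 * u2| * (x0 ^ (-r) * x2 ^ (-r)) +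
      (if |u1 + 2 * u2| ≤ 1 then x0 ^ (-r) + x2 ^ (-r) else 0)) := by
  set u := u1 + u2 with hu
  have k0 : 0 ≤ x0 ^ (-r) := by positivity
  have k2 : 0 ≤ x2 ^ (-r) := by positivity
  have hN : N1 * N2 ≤ x1 ^ (-(7/8 : ℝ)) * x2 ^ (-(7/8 : ℝ)) := by gcongr
  have hNN : 0 ≤ N1 * N2 := by positivity
  have jac0 : 0 ≤ |u1| * |u1 + 2 * u2| * (x0 ^ (-r) * x2 ^ (-r)) := by positivity
  have hmul : |u| ≤ 2 * |u1 * u2| := pt_aux4 hu1 hu2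
  have e : 2 * u = u1 + (u1 + 2 * u2) := by rw [hu]; ring
  have ht := abs_add_le u1 (u1 + 2 * u2)
  rw [← e, abs_mul, abs_two] at ht
  rcases le_or_gt |u| 1 with hlow | hhigh
  · have hu2 : u ^ 2 ≤ 1 := by rw [← sq_abs]; nlinarith [abs_nonneg u]
    have hGN : u ^ 2 * (G * (N1 * N2)) ≤ C * (x1 ^ (-(7/8 : ℝ)) * (x0 ^ (-(2/3 : ℝ)) * x2 ^ (-(7/8 : ℝ)))) := by
      calc u ^ 2 * (G * (N1 * N2)) ≤ 1 * (C * x0 ^ (-(2/3 : ℝ)) * (x1 ^ (-(7/8 : ℝ)) * x2 ^ (-(7/8 : ℝ)))) := by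
            gcongr
        _ = _ := by ring
    rcases le_or_gt |u1 + 2 * u2| 1 with hD | hD
    · rw [if_pos hD]
      have h4 := ptA (r := r) h0 h2 (show (0:ℝ) ≤ 2/3 by norm_num) (show (0:ℝ) ≤ 7/8 by norm_num) (by linarith)
      have h5 : x1 ^ (-(7/8 : ℝ)) ≤ 1 := Real.rpow_le_one_of_one_le_of_nonpos h1 (by norm_num)
      calc u ^ 2 * (G * (N1 * N2)) ≤ _ := hGN
        _ ≤ C * (1 * (x0 ^ (-r) + x2 ^ (-r))) := by gcongr
        _ ≤ 4 * C * ((x0 ^ (-r) + x2 ^ (-r)) + |u1| * |u1 + 2 * u2| * (x0 ^ (-r) * x2 ^ (-r))) :=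
            pt_fin (by linarith) (by norm_num) (by positivity) jac0
        _ = _ := by ring
    · rw [if_neg (by linarith)]
      have hk := ptC (e := 7/8) (a := 2/3) (b := 7/8) (r := r) (f := 0) h0 h01 h2 h21
        (by linarith) (by linarith) (by linarith)
      rw [neg_zero, Real.rpow_zero, one_mul] at hk
      have : 1 ≤ |u1| * |u1 + 2 * u2| := by nlinarith
      calc u ^ 2 * (G * (N1 * N2)) ≤ _ := hGN
        _ ≤ C * (1 * (x0 ^ (-r) * x2 ^ (-r))) := by rw [one_mul]; gcongr
        _ ≤ C * (|u1| * |u1 + 2 * u2| * (x0 ^ (-r) * x2 ^ (-r))) := by gcongr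
        _ = C * (1 * (|u1| * |u1 + 2 * u2| * (x0 ^ (-r) * x2 ^ (-r)))) := by ring
        _ ≤ _ := pt_fin (by linarith) (by norm_num) jac0 le_rfl
  · have hGN : u ^ 2 * (G * (N1 * N2)) ≤ u ^ 2 * (C * x0 ^ (-(7/8 : ℝ)) * (x1 ^ (-(7/8 : ℝ)) * x2 ^ (-(7/8 : ℝ)))) := by
      have := hGh hhigh
      gcongr
    rcases le_or_gt |u1 + 2 * u2| 1 with hD | hD
    · rw [if_pos hD]
      have hc : |u| ^ 3 ≤ 8 * x1 := by
        have a1 : |u| ≤ |u1| := by linarith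
        have a2 : |u| ≤ 2 * |u2| := by
          have e : u = -u2 + (u1 + 2 * u2) := by rw [hu]; ring
          have := abs_add_le (-u2) (u1 + 2 * u2)
          rw [← e, abs_neg] at this
          linarith
        rw [mul_assoc, abs_mul, abs_mul] at hres
        exact pt_aux3 (abs_nonneg u) a1 a2 hres
      have h3 := pt_cube h1 hc
      have h4 := ptA (r := r) h0 h2 (show (0:ℝ) ≤ 7/8 by norm_num) (show (0:ℝ) ≤ 7/8 by norm_num) (by linarith)
      calc u ^ 2 * (G * (N1 * N2)) ≤ _ := hGN
        _ = C * ((u ^ 2 * x1 ^ (-(7/8 : ℝ))) * (x0 ^ (-(7/8 : ℝ)) * x2 ^ (-(7/8 : ℝ)))) := by ring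
        _ ≤ C * (4 * (x0 ^ (-r) + x2 ^ (-r))) := by gcongr
        _ ≤ 4 * C * ((x0 ^ (-r) + x2 ^ (-r)) + |u1| * |u1 + 2 * u2| * (x0 ^ (-r) * x2 ^ (-r))) :=
            pt_fin (by linarith) (by norm_num) (by positivity) jac0
        _ = _ := by ring
    · rw [if_neg (by linarith)]
      have hk := ptC (e := 7/8) (a := 7/8) (b := 7/8) (r := r) (f := 1/2) h0 h01 h2 h21
        (by linarith) (by linarith) (by linarith)
      have hsq : u ^ 2 ≤ 2 * x1 := by
        rw [mul_assoc, abs_mul] at hres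
        rw [← sq_abs]
        exact pt_aux1 (abs_nonneg u) hmul hres
      have h3 := pt_sq h1 hsq
      have hj : |u| ≤ |u1| * |u1 + 2 * u2| := pt_aux2 hu1 hD ht
      calc u ^ 2 * (G * (N1 * N2)) ≤ _ := hGN
        _ = C * (u ^ 2 * (x1 ^ (-(7/8 : ℝ)) * (x0 ^ (-(7/8 : ℝ)) * x2 ^ (-(7/8 : ℝ))))) := by ring
        _ ≤ C * (u ^ 2 * (x1 ^ (-(1/2 : ℝ)) * (x0 ^ (-r) * x2 ^ (-r)))) := by gcongr
        _ = C * ((u ^ 2 * x1 ^ (-(1/2 : ℝ))) * (x0 ^ (-r) * x2 ^ (-r))) := by ring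
        _ ≤ C * ((2 * |u|) * (x0 ^ (-r) * x2 ^ (-r))) := by gcongr
        _ ≤ C * ((2 * (|u1| * |u1 + 2 * u2|)) * (x0 ^ (-r) * x2 ^ (-r))) := by gcongr
        _ = C * (2 * (|u1| * |u1 + 2 * u2| * (x0 ^ (-r) * x2 ^ (-r)))) := by ring
        _ ≤ _ := pt_fin (by linarith) (by norm_num) jac0 le_rfl

/-- low `u2` -/
lemma pt_low {r C x0 x1 x2 u1 u2 G N1 N2 : ℝ} (hr1 : 1 < r) (hr2 : r ≤ 17/16) (hC : 1 ≤ C)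
    (h0 : 1 ≤ x0) (h1 : 1 ≤ x1) (h2 : 1 ≤ x2) (hu2 : |u2| ≤ 1)
    (hG : 0 ≤ G) (hN1 : 0 ≤ N1) (hN2 : 0 ≤ N2)
    (hGl : G ≤ C * x0 ^ (-(2/3 : ℝ))) (hGh : 1 < |u1 + u2| → G ≤ C * x0 ^ (-(7/8 : ℝ)))
    (hN1h : N1 ≤ x1 ^ (-(7/8 : ℝ))) (hN2l : N2 ≤ C * x2 ^ (-r)) :
    (u1 + u2) ^ 2 * (G * (N1 * N2)) ≤ 16 * C ^ 2 *
      (|u1 + u2| * |u1 - u2| * (x1 ^ (-r) * x2 ^ (-r)) +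
      (|u1| * |u1 + 2 * u2| * (x0 ^ (-r) * x2 ^ (-r)) + (if |u2| ≤ 1 then x2 ^ (-r) else 0))) := by
  set u := u1 + u2 with hu
  have k0 : 0 ≤ x0 ^ (-r) := by positivity
  have k1 : 0 ≤ x1 ^ (-r) := by positivity
  have k2 : 0 ≤ x2 ^ (-r) := by positivity
  rw [if_pos hu2]
  have j0 : 0 ≤ |u| * |u1 - u2| * (x1 ^ (-r) * x2 ^ (-r)) := by positivity
  have j1 : 0 ≤ |u1| * |u1 + 2 * u2| * (x0 ^ (-r) * x2 ^ (-r)) := by positivity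
  have hCC : 0 ≤ 16 * C ^ 2 := by positivity
  rcases le_or_gt |u| 4 with hl | hh
  · have b1 : u ^ 2 ≤ 16 := by rw [← sq_abs]; nlinarith [abs_nonneg u]
    have b2 : G ≤ C * 1 := hGl.trans (by
      gcongr; exact Real.rpow_le_one_of_one_le_of_nonpos h0 (by norm_num))
    have b3 : N1 ≤ 1 := hN1h.trans (Real.rpow_le_one_of_one_le_of_nonpos h1 (by norm_num))
    calc u ^ 2 * (G * (N1 * N2)) ≤ 16 * ((C * 1) * (1 * (C * x2 ^ (-r)))) := by gcongr
      _ = 16 * C ^ 2 * x2 ^ (-r) := by ring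
      _ ≤ _ := by gcongr; linarith
  · have hG' := hGh (by linarith)
    have hGN : u ^ 2 * (G * (N1 * N2)) ≤ u ^ 2 * ((C * x0 ^ (-(7/8 : ℝ))) * (x1 ^ (-(7/8 : ℝ)) * (C * x2 ^ (-r)))) := by
      gcongr
    have a1 : |u| ≤ 2 * |u1| := by
      have := abs_add_le u1 u2
      rw [← hu] at this; linarith
    have a2 : |u| ≤ 2 * |u1 + 2 * u2| := by
      have e : u = (u1 + 2 * u2) + -u2 := by rw [hu]; ring
      have := abs_add_le (u1 + 2 * u2) (-u2)
      rw [← e, abs_neg] at this; linarith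
    have a3 : |u| ≤ 2 * |u1 - u2| := by
      have e : u = (u1 - u2) + 2 * u2 := by rw [hu]; ring
      have := abs_add_le (u1 - u2) (2 * u2)
      rw [← e, abs_mul, abs_two] at this; linarith
    rcases le_total x1 x0 with h10 | h01
    · have hk := ptC (e := 7/8) (a := 7/8) (b := r) (r := r) (f := 0) h1 h10 h0 le_rfl
        (by linarith) (by linarith) (by linarith)
      have hb : x0 ^ (-(7/8 : ℝ)) * x1 ^ (-(7/8 : ℝ)) ≤ x1 ^ (-r) := by
        have h1' := ptB (a := 7/8) (r := r) h1 h10 (by linarith)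
        have hx0 : (0:ℝ) < x0 := by linarith
        calc x0 ^ (-(7/8 : ℝ)) * x1 ^ (-(7/8 : ℝ)) ≤ x0 ^ (-(7/8 : ℝ)) * (x0 ^ (r - 7/8) * x1 ^ (-r)) := by gcongr
          _ = x0 ^ (-(7/8 : ℝ) + (r - 7/8)) * x1 ^ (-r) := by rw [Real.rpow_add hx0]; ring
          _ ≤ 1 * x1 ^ (-r) := by
              gcongr; exact Real.rpow_le_one_of_one_le_of_nonpos h0 (by linarith)
          _ = _ := one_mul _
      have hj : u ^ 2 ≤ 4 * (|u| * |u1 - u2|) := by rw [← sq_abs]; nlinarith [abs_nonneg u]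
      calc u ^ 2 * (G * (N1 * N2)) ≤ _ := hGN
        _ = C ^ 2 * (u ^ 2 * ((x0 ^ (-(7/8 : ℝ)) * x1 ^ (-(7/8 : ℝ))) * x2 ^ (-r))) := by ring
        _ ≤ C ^ 2 * ((4 * (|u| * |u1 - u2|)) * (x1 ^ (-r) * x2 ^ (-r))) := by gcongr
        _ ≤ 16 * C ^ 2 * (|u| * |u1 - u2| * (x1 ^ (-r) * x2 ^ (-r))) := by
            nlinarith [mul_nonneg (sq_nonneg C) j0]
        _ ≤ _ := by gcongr; linarith
    · have hb : x0 ^ (-(7/8 : ℝ)) * x1 ^ (-(7/8 : ℝ)) ≤ x0 ^ (-r) := by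
        have h1' := ptB (a := 7/8) (r := r) h0 h01 (by linarith)
        have hx1 : (0:ℝ) < x1 := by linarith
        calc x0 ^ (-(7/8 : ℝ)) * x1 ^ (-(7/8 : ℝ)) ≤ (x1 ^ (r - 7/8) * x0 ^ (-r)) * x1 ^ (-(7/8 : ℝ)) := by gcongr
          _ = x1 ^ (-(7/8 : ℝ) + (r - 7/8)) * x0 ^ (-r) := by rw [Real.rpow_add hx1]; ring
          _ ≤ 1 * x0 ^ (-r) := by
              gcongr; exact Real.rpow_le_one_of_one_le_of_nonpos h1 (by linarith)
          _ = _ := one_mul _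
      have hj : u ^ 2 ≤ 4 * (|u1| * |u1 + 2 * u2|) := by rw [← sq_abs]; nlinarith [abs_nonneg u]
      calc u ^ 2 * (G * (N1 * N2)) ≤ _ := hGN
        _ = C ^ 2 * (u ^ 2 * ((x0 ^ (-(7/8 : ℝ)) * x1 ^ (-(7/8 : ℝ))) * x2 ^ (-r))) := by ring
        _ ≤ C ^ 2 * ((4 * (|u1| * |u1 + 2 * u2|)) * (x0 ^ (-r) * x2 ^ (-r))) := by gcongr
        _ ≤ 16 * C ^ 2 * (|u1| * |u1 + 2 * u2| * (x0 ^ (-r) * x2 ^ (-r))) := by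
            nlinarith [mul_nonneg (sq_nonneg C) j1]
        _ ≤ _ := by gcongr; linarith

/-- kernels -/
noncomputable def ker0 (r x1 x2 u1 u2 : ℝ) : ℝ :=
  |u1 + u2| * |u1 - u2| * (x1 ^ (-r) * x2 ^ (-r)) +
      (if |u1 - u2| ≤ 1 then x1 ^ (-r) + x2 ^ (-r) else 0)

noncomputable def ker1 (r x0 x2 u1 u2 : ℝ) : ℝ :=
  |u1| * |u1 + 2 * u2| * (x0 ^ (-r) * x2 ^ (-r)) +
      (if |u1 + 2 * u2| ≤ 1 then x0 ^ (-r) + x2 ^ (-r) else 0) + (if |u2| ≤ 1 then x2 ^ (-r) else 0)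

lemma ker0_nonneg {r x1 x2 u1 u2 : ℝ} (h1 : 0 ≤ x1) (h2 : 0 ≤ x2) : 0 ≤ ker0 r x1 x2 u1 u2 := by
  unfold ker0; split_ifs <;> positivity

lemma ker1_nonneg {r x1 x2 u1 u2 : ℝ} (h1 : 0 ≤ x1) (h2 : 0 ≤ x2) : 0 ≤ ker1 r x1 x2 u1 u2 := by
  unfold ker1; split_ifs <;> positivity

lemma ker0_comm (r x1 x2 u1 u2 : ℝ) : ker0 r x2 x1 u2 u1 = ker0 r x1 x2 u1 u2 := by
  unfold ker0
  rw [abs_sub_comm u2 u1, add_comm u2 u1, add_comm (x2 ^ (-r)), mul_comm (x2 ^ (-r))]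

lemma pt_all {r C x0 x1 x2 u1 u2 G N1 N2 : ℝ} (hr1 : 1 < r) (hr2 : r ≤ 17/16) (hC : 1 ≤ C)
    (h0 : 1 ≤ x0) (h1 : 1 ≤ x1) (h2 : 1 ≤ x2)
    (hres : 3 * |(u1 + u2) * u1 * u2| ≤ x0 + x1 + x2)
    (hG : 0 ≤ G) (hN1 : 0 ≤ N1) (hN2 : 0 ≤ N2)
    (hGl : G ≤ C * x0 ^ (-(2/3 : ℝ))) (hGh : 1 < |u1 + u2| → G ≤ C * x0 ^ (-(7/8 : ℝ)))
    (hN1h : N1 ≤ x1 ^ (-(7/8 : ℝ))) (hN2h : N2 ≤ x2 ^ (-(7/8 : ℝ)))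
    (hN1l : |u1| ≤ 1 → N1 ≤ C * x1 ^ (-r)) (hN2l : |u2| ≤ 1 → N2 ≤ C * x2 ^ (-r)) :
    (u1 + u2) ^ 2 * (G * (N1 * N2)) ≤
      16 * C ^ 2 * (ker0 r x1 x2 u1 u2 + ker1 r x0 x2 u1 u2 + ker1 r x0 x1 u2 u1) := by
  have p0 := ker0_nonneg (r := r) (u1 := u1) (u2 := u2) (show 0 ≤ x1 by linarith) (show 0 ≤ x2 by linarith)
  have p1 := ker1_nonneg (r := r) (u1 := u1) (u2 := u2) (show 0 ≤ x0 by linarith) (show 0 ≤ x2 by linarith)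
  have p2 := ker1_nonneg (r := r) (u1 := u2) (u2 := u1) (show 0 ≤ x0 by linarith) (show 0 ≤ x1 by linarith)
  have k0 : 0 ≤ x0 ^ (-r) := by positivity
  have k1 : 0 ≤ x1 ^ (-r) := by positivity
  have k2 : 0 ≤ x2 ^ (-r) := by positivity
  have hCC : 4 * C ≤ 16 * C ^ 2 := by nlinarith
  rcases le_or_gt |u2| 1 with hu2 | hu2
  · refine (pt_low hr1 hr2 hC h0 h1 h2 hu2 hG hN1 hN2 hGl hGh hN1h (hN2l hu2)).trans ?_
    refine mul_le_mul_of_nonneg_left ?_ (by positivity)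
    have q0 : |u1 + u2| * |u1 - u2| * (x1 ^ (-r) * x2 ^ (-r)) ≤ ker0 r x1 x2 u1 u2 := by
      unfold ker0; split_ifs <;> linarith
    have q1 : |u1| * |u1 + 2 * u2| * (x0 ^ (-r) * x2 ^ (-r)) + (if |u2| ≤ 1 then x2 ^ (-r) else 0) ≤ ker1 r x0 x2 u1 u2 := by
      unfold ker1; split_ifs <;> linarith
    linarith
  rcases le_or_gt |u1| 1 with hu1 | hu1
  · have := pt_low hr1 hr2 hC h0 h2 h1 hu1 hG hN2 hN1 hGl (by rwa [add_comm u2 u1]) hN2h (hN1l hu1)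
    rw [add_comm u2 u1, mul_comm N2 N1] at this
    refine this.trans ?_
    refine mul_le_mul_of_nonneg_left ?_ (by positivity)
    have q0 : |u1 + u2| * |u2 - u1| * (x2 ^ (-r) * x1 ^ (-r)) ≤ ker0 r x1 x2 u1 u2 := by
      rw [abs_sub_comm, mul_comm (x2 ^ (-r))]
      unfold ker0; split_ifs <;> linarith
    have q1 : |u2| * |u2 + 2 * u1| * (x0 ^ (-r) * x1 ^ (-r)) + (if |u1| ≤ 1 then x1 ^ (-r) else 0) ≤ ker1 r x0 x1 u2 u1 := by
      unfold ker1; split_ifs <;> linarith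
    linarith
  by_cases m0 : x1 ≤ x0 ∧ x2 ≤ x0
  · refine (pt_c0 hr1 hr2 hC h0 h1 h2 m0.1 m0.2 (by linarith) hu1 hu2 hG hN1 hN2 hGl hGh hN1h hN2h).trans ?_
    have : 4 * C * ker0 r x1 x2 u1 u2 ≤ 16 * C ^ 2 * (ker0 r x1 x2 u1 u2 + ker1 r x0 x2 u1 u2 + ker1 r x0 x1 u2 u1) := by
      gcongr; linarith
    exact this
  by_cases m1 : x0 ≤ x1 ∧ x2 ≤ x1
  · refine (pt_c1 hr1 hr2 hC h0 h1 h2 m1.1 m1.2 (by linarith) hu1 hu2 hG hN1 hN2 hGl hGh hN1h hN2h).trans ?_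
    refine mul_le_mul hCC ?_ (by split_ifs <;> positivity) (by positivity)
    have q1 : |u1| * |u1 + 2 * u2| * (x0 ^ (-r) * x2 ^ (-r)) +  (if |u1 + 2 * u2| ≤ 1 then x0 ^ (-r) + x2 ^ (-r) else 0) ≤ ker1 r x0 x2 u1 u2 := by
      unfold ker1; split_ifs <;> linarith
    linarith
  have m2 : x0 ≤ x2 ∧ x1 ≤ x2 := by
    rcases le_total x0 x1 with a | a <;> rcases le_total x1 x2 with b | b <;>
      rcases le_total x0 x2 with c | c <;> grind
  · have := pt_c1 hr1 hr2 hC h0 h2 h1 m2.1 m2.2 (u1 := u2) (u2 := u1)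
      (by rw [add_comm u2 u1, mul_right_comm]; linarith) hu2 hu1 hG hN2 hN1 hGl
      (by rwa [add_comm u2 u1]) hN2h hN1h
    rw [add_comm u2 u1, mul_comm N2 N1] at this
    refine this.trans ?_
    refine mul_le_mul hCC ?_ (by split_ifs <;> positivity) (by positivity)
    have q1 : |u2| * |u2 + 2 * u1| * (x0 ^ (-r) * x1 ^ (-r)) +  (if |u2 + 2 * u1| ≤ 1 then x0 ^ (-r) + x1 ^ (-r) else 0) ≤ ker1 r x0 x1 u2 u1 := by
      unfold ker1; split_ifs <;> linarith
    linarith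

end

section

open MeasureTheory

noncomputable def kap (r : ℝ) : ENNReal := ∫⁻ x : ℝ, ENNReal.ofReal ((1 + |x|) ^ (-r))

lemma kap_lt_top {r : ℝ} (hr : 1 < r) : kap r < ⊤ := by
  have h := integrable_one_add_norm (E := ℝ) (μ := volume) (r := r) (by simpa using hr)
  have h2 := h.lintegral_lt_top
  simpa [kap, Real.norm_eq_abs] using h2

lemma quad_cov (a c m : ℝ) (B : ℝ → ENNReal) :
    ∫⁻ x : ℝ, ENNReal.ofReal |a * (m - 2 * x)| * B (c + a * (x * (m - x))) ≤ 2 * ∫⁻ y, B y := by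
  rcases eq_or_ne a 0 with ha | ha
  · subst ha; simp
  have hd : ∀ x : ℝ, HasDerivAt (fun x => c + a * (x * (m - x))) (a * (m - 2 * x)) x := by
    intro x
    have h := (((hasDerivAt_id x).mul ((hasDerivAt_const x m).sub (hasDerivAt_id x))).const_mul a).const_add c
    refine h.congr_deriv ?_
    simp only [Pi.sub_apply, id_eq]; ring
  have key : ∀ s : Set ℝ, MeasurableSet s → Set.InjOn (fun x => c + a * (x * (m - x))) s →
      ∫⁻ x in s, ENNReal.ofReal |a * (m - 2 * x)| * B (c + a * (x * (m - x))) ≤ ∫⁻ y, B y := by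
    intro s hs hi
    rw [← lintegral_image_eq_lintegral_abs_deriv_mul hs (fun x _ => (hd x).hasDerivWithinAt) hi B]
    exact setLIntegral_le_lintegral _ _
  have h1 := key (Set.Ici (m/2)) measurableSet_Ici (by
    intro x hx y hy hxy
    simp only [Set.mem_Ici] at hx hy
    have : (x - y) * (m - x - y) = 0 := by
      have : a * ((x - y) * (m - x - y)) = 0 := by simp only at hxy; linarith
      simpa [ha] using this
    rcases mul_eq_zero.1 this with h | h <;> linarith)
  have h2 := key (Set.Ici (m/2))ᶜ measurableSet_Ici.compl (by
    intro x hx y hy hxy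
    simp only [Set.mem_compl_iff, Set.mem_Ici, not_le] at hx hy
    have : (x - y) * (m - x - y) = 0 := by
      have : a * ((x - y) * (m - x - y)) = 0 := by simp only at hxy; linarith
      simpa [ha] using this
    rcases mul_eq_zero.1 this with h | h <;> linarith)
  rw [← lintegral_add_compl _ (measurableSet_Ici (a := m/2)), two_mul]
  exact add_le_add h1 h2

lemma shear_lint (h : ℝ → ℝ) (hh : Measurable h) (F : ℝ × ℝ → ENNReal) (hF : Measurable F) :
    ∫⁻ p, F p = ∫⁻ l : ℝ, ∫⁻ x : ℝ, F (l + h x, x) := by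
  rw [Measure.volume_eq_prod, lintegral_prod_symm _ hF.aemeasurable]
  rw [lintegral_lintegral_swap (μ := volume) (ν := volume) (f := fun l x => F (l + h x, x))]
  · refine lintegral_congr fun x => ?_
    exact (lintegral_add_right_eq_self (μ := volume) (fun t => F (t, x)) (h x)).symm
  · apply Measurable.aemeasurable
    have : Measurable fun z : ℝ × ℝ => (z.1 + h z.2, z.2) := by fun_prop
    exact hF.comp this

lemma jac_int (r β a c m : ℝ) :
    ∫⁻ p : ℝ × ℝ, ENNReal.ofReal (|a * (m - 2 * p.2)| * ((1 + |p.1 - p.2 ^ 3 + β * p.2|) ^ (-r) *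
      (1 + |p.1 - p.2 ^ 3 + β * p.2 + (c + a * (p.2 * (m - p.2)))|) ^ (-r))) ≤ kap r * (2 * kap r) := by
  rw [shear_lint (fun x => x ^ 3 - β * x) (by fun_prop) _ (by fun_prop)]
  have : ∀ l : ℝ, ∫⁻ x : ℝ, ENNReal.ofReal (|a * (m - 2 * x)| * ((1 + |l + (x ^ 3 - β * x) - x ^ 3 + β * x|) ^ (-r) *
      (1 + |l + (x ^ 3 - β * x) - x ^ 3 + β * x + (c + a * (x * (m - x)))|) ^ (-r))) ≤
      ENNReal.ofReal ((1 + |l|) ^ (-r)) * (2 * kap r) := by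
    intro l
    have e : ∀ x : ℝ, ENNReal.ofReal (|a * (m - 2 * x)| * ((1 + |l + (x ^ 3 - β * x) - x ^ 3 + β * x|) ^ (-r) *
      (1 + |l + (x ^ 3 - β * x) - x ^ 3 + β * x + (c + a * (x * (m - x)))|) ^ (-r))) =
      ENNReal.ofReal ((1 + |l|) ^ (-r)) * (ENNReal.ofReal |a * (m - 2 * x)| *
        (fun y => ENNReal.ofReal ((1 + |y|) ^ (-r))) (l + c + a * (x * (m - x)))) := by
      intro x
      have e1 : l + (x ^ 3 - β * x) - x ^ 3 + β * x = l := by ring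
      rw [e1, ← add_assoc]
      rw [ENNReal.ofReal_mul (abs_nonneg _), ENNReal.ofReal_mul (by positivity)]
      ring
    simp_rw [e]
    rw [lintegral_const_mul' _ _ ENNReal.ofReal_ne_top]
    gcongr
    exact quad_cov a (l + c) m _
  refine (lintegral_mono this).trans ?_
  rw [lintegral_mul_const _ (by fun_prop)]
  rfl

lemma strip_int (r m : ℝ) (P : ℝ → Prop) [DecidablePred P] (hP : ∀ x, P x → |x - m| ≤ 1) (h : ℝ → ℝ) (hh : Measurable h) :
    ∫⁻ p : ℝ × ℝ, ENNReal.ofReal (if P p.2 then (1 + |p.1 + h p.2|) ^ (-r) else 0) ≤ 2 * kap r := by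
  have hm : Measurable fun p : ℝ × ℝ => Set.indicator (Set.Icc (m-1) (m+1)) (fun _ => (1:ENNReal)) p.2 *
      ENNReal.ofReal ((1 + |p.1 + h p.2|) ^ (-r)) := by
    have : Measurable (Set.indicator (Set.Icc (m-1) (m+1)) (fun _ => (1:ENNReal))) :=
      measurable_const.indicator measurableSet_Icc
    fun_prop
  calc _ ≤ ∫⁻ p : ℝ × ℝ, Set.indicator (Set.Icc (m-1) (m+1)) (fun _ => (1:ENNReal)) p.2 *
      ENNReal.ofReal ((1 + |p.1 + h p.2|) ^ (-r)) := by
        refine lintegral_mono fun p => ?_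
        simp only
        split_ifs with hp
        · have := abs_le.1 (hP _ hp)
          rw [Set.indicator_of_mem (by constructor <;> linarith), one_mul]
        · simp
    _ = ∫⁻ x : ℝ, Set.indicator (Set.Icc (m-1) (m+1)) (fun _ => (1:ENNReal)) x * kap r := by
        rw [Measure.volume_eq_prod, lintegral_prod_symm _ hm.aemeasurable]
        refine lintegral_congr fun x => ?_
        simp only
        rw [lintegral_const_mul _ (by fun_prop)]
        congr 1
        exact lintegral_add_right_eq_self (fun t => ENNReal.ofReal ((1 + |t|) ^ (-r))) (h x)
    _ = 2 * kap r := by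
        rw [lintegral_mul_const _ (measurable_const.indicator measurableSet_Icc),
          lintegral_indicator measurableSet_Icc]
        simp
        norm_num

noncomputable def Xm (β : ℝ) (p : ℝ × ℝ) : ℝ := 1 + |p.1 - p.2 ^ 3 + β * p.2|

lemma one_le_Xm (β : ℝ) (p : ℝ × ℝ) : 1 ≤ Xm β p := by unfold Xm; linarith [abs_nonneg (p.1 - p.2 ^ 3 + β * p.2)]

lemma ite_split (P : Prop) [Decidable P] {a b : ℝ} (ha : 0 ≤ a) (hb : 0 ≤ b) :
    ENNReal.ofReal (if P then a + b else 0) = ENNReal.ofReal (if P then a else 0) + ENNReal.ofReal (if P then b else 0) := by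
  split_ifs
  · exact ENNReal.ofReal_add ha hb
  · simp

lemma meas_ite (r : ℝ) {P : ℝ → Prop} [DecidablePred P] (hP : MeasurableSet {x | P x}) (f : ℝ × ℝ → ℝ) (hf : Measurable f) :
    Measurable fun p : ℝ × ℝ => ENNReal.ofReal (if P p.2 then (f p) ^ (-r) else 0) := by
  apply Measurable.ennreal_ofReal
  refine Measurable.ite (measurable_snd hP) (by fun_prop) measurable_const

lemma meas_Xm (β : ℝ) : Measurable (Xm β) := by unfold Xm; fun_prop

lemma ker0_int (r β : ℝ) (p : ℝ × ℝ) :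
    ∫⁻ p1 : ℝ × ℝ, ENNReal.ofReal (ker0 r (Xm β p1) (Xm β (p - p1)) p1.2 (p - p1).2) ≤
      kap r * (2 * kap r) + (2 * kap r + 2 * kap r) := by
  obtain ⟨t, x⟩ := p
  have hXm := meas_Xm β
  have pos : ∀ q, 0 ≤ Xm β q := fun q => zero_le_one.trans (one_le_Xm β q)
  have hms : MeasurableSet {y : ℝ | |y - (x - y)| ≤ 1} := measurableSet_le (by fun_prop) (by fun_prop)
  have e : ∀ p1 : ℝ × ℝ, ENNReal.ofReal (ker0 r (Xm β p1) (Xm β ((t, x) - p1)) p1.2 ((t, x) - p1).2) =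
      ENNReal.ofReal (|p1.2 + (x - p1.2)| * |p1.2 - (x - p1.2)| * ((Xm β p1) ^ (-r) * (Xm β ((t, x) - p1)) ^ (-r))) +
      (ENNReal.ofReal (if |p1.2 - (x - p1.2)| ≤ 1 then (Xm β p1) ^ (-r) else 0) +
       ENNReal.ofReal (if |p1.2 - (x - p1.2)| ≤ 1 then (Xm β ((t, x) - p1)) ^ (-r) else 0)) := by
    intro p1
    have h1 := Real.rpow_nonneg (pos p1) (-r)
    have h2 := Real.rpow_nonneg (pos ((t, x) - p1)) (-r)
    rw [← ite_split _ h1 h2, ← ENNReal.ofReal_add (by positivity) (by split_ifs <;> positivity)]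
    rfl
  simp_rw [e]
  rw [lintegral_add_right, lintegral_add_right]
  rotate_left
  · exact meas_ite r (P := fun y => |y - (x - y)| ≤ 1) hms _ (by fun_prop)
  · exact (meas_ite r (P := fun y => |y - (x - y)| ≤ 1) hms _ (by fun_prop)).add
      (meas_ite r (P := fun y => |y - (x - y)| ≤ 1) hms _ (by fun_prop))
  gcongr
  · refine le_trans (lintegral_mono fun p1 => ?_) (jac_int r β (-3 * x) (-(t - x ^ 3 + β * x)) x)
    apply ENNReal.ofReal_le_ofReal
    have h1 := Real.rpow_nonneg (pos p1) (-r)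
    have h2 := Real.rpow_nonneg (pos ((t, x) - p1)) (-r)
    have ex : Xm β ((t, x) - p1) = 1 + |p1.1 - p1.2 ^ 3 + β * p1.2 + (-(t - x ^ 3 + β * x) + -3 * x * (p1.2 * (x - p1.2)))| := by
      unfold Xm
      rw [← abs_neg]
      simp only [Prod.fst_sub, Prod.snd_sub]
      congr 2; ring
    rw [← ex]
    change _ ≤ _ * ((Xm β p1) ^ (-r) * _)
    gcongr
    rw [abs_mul, abs_mul, abs_sub_comm]
    have : x - p1.2 - p1.2 = x - 2 * p1.2 := by ring
    rw [this]
    have : p1.2 + (x - p1.2) = x := by ring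
    rw [this]
    gcongr
    norm_num
    nlinarith [abs_nonneg x]
  · have := strip_int r (x/2) (fun y => |y - (x - y)| ≤ 1) (by
      intro y hy; rw [abs_le] at *; constructor <;> linarith) (fun y => - y ^ 3 + β * y) (by fun_prop)
    refine le_trans (le_of_eq (lintegral_congr fun p1 => ?_)) this
    simp only [Xm]
    ring_nf
  · have := strip_int r (x/2) (fun y => |y - (x - y)| ≤ 1) (by
      intro y hy; rw [abs_le] at *; constructor <;> linarith) (fun y => - (t - (x - y) ^ 3 + β * (x - y))) (by fun_prop)
    refine le_trans (le_of_eq (lintegral_congr fun p1 => ?_)) this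
    have ex : Xm β ((t, x) - p1) = 1 + |p1.1 + - (t - (x - p1.2) ^ 3 + β * (x - p1.2))| := by
      unfold Xm
      rw [← abs_neg]
      simp only [Prod.fst_sub, Prod.snd_sub]
      congr 2; ring
    rw [ex]

lemma ker1_int (r β : ℝ) (p : ℝ × ℝ) :
    ∫⁻ q : ℝ × ℝ, ENNReal.ofReal (ker1 r (Xm β (p + q)) (Xm β q) p.2 q.2) ≤
      kap r * (2 * kap r) + (2 * kap r + 2 * kap r) + 2 * kap r := by
  obtain ⟨t, x⟩ := p
  have hXm := meas_Xm β
  have pos : ∀ q, 0 ≤ Xm β q := fun q => zero_le_one.trans (one_le_Xm β q)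
  have hms : MeasurableSet {y : ℝ | |x + 2 * y| ≤ 1} := measurableSet_le (by fun_prop) (by fun_prop)
  have hms2 : MeasurableSet {y : ℝ | |y| ≤ 1} := measurableSet_le (by fun_prop) (by fun_prop)
  have e : ∀ q : ℝ × ℝ, ENNReal.ofReal (ker1 r (Xm β ((t, x) + q)) (Xm β q) x q.2) =
      ENNReal.ofReal (|x| * |x + 2 * q.2| * ((Xm β ((t, x) + q)) ^ (-r) * (Xm β q) ^ (-r))) +
      (ENNReal.ofReal (if |x + 2 * q.2| ≤ 1 then (Xm β ((t, x) + q)) ^ (-r) else 0) +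
       ENNReal.ofReal (if |x + 2 * q.2| ≤ 1 then (Xm β q) ^ (-r) else 0)) +
      ENNReal.ofReal (if |q.2| ≤ 1 then (Xm β q) ^ (-r) else 0) := by
    intro q
    have h1 := Real.rpow_nonneg (pos q) (-r)
    have h2 := Real.rpow_nonneg (pos ((t, x) + q)) (-r)
    rw [← ite_split _ h2 h1, ← ENNReal.ofReal_add (by positivity) (by split_ifs <;> positivity),
      ← ENNReal.ofReal_add (by split_ifs <;> positivity) (by split_ifs <;> positivity)]
    rfl
  simp only
  simp_rw [e]
  have m1 := meas_ite r (P := fun y => |x + 2 * y| ≤ 1) hms (fun q => Xm β ((t, x) + q)) (by fun_prop)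
  have m2 := meas_ite r (P := fun y => |x + 2 * y| ≤ 1) hms (fun q => Xm β q) (by fun_prop)
  have m3 := meas_ite r (P := fun y => |y| ≤ 1) hms2 (fun q => Xm β q) (by fun_prop)
  rw [lintegral_add_right _ m3, lintegral_add_right _ (m1.fun_add m2), lintegral_add_right _ m2]
  gcongr
  · refine le_trans (lintegral_mono fun q => ?_) (jac_int r β (3 * x) (t - x ^ 3 + β * x) (-x))
    apply ENNReal.ofReal_le_ofReal
    have h1 := Real.rpow_nonneg (pos q) (-r)
    have h2 := Real.rpow_nonneg (pos ((t, x) + q)) (-r)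
    have ex : Xm β ((t, x) + q) = 1 + |q.1 - q.2 ^ 3 + β * q.2 + (t - x ^ 3 + β * x + 3 * x * (q.2 * (-x - q.2)))| := by
      unfold Xm
      simp only [Prod.fst_add, Prod.snd_add]
      congr 2; ring
    rw [← ex]
    change _ ≤ _ * ((Xm β q) ^ (-r) * _)
    rw [mul_comm (Xm β q ^ (-r))]
    gcongr
    rw [abs_mul, abs_mul]
    have : |-x - 2 * q.2| = |x + 2 * q.2| := by rw [← abs_neg]; congr 1; ring
    rw [this]
    gcongr
    norm_num
    nlinarith [abs_nonneg x]
  · have := strip_int r (-x/2) (fun y => |x + 2 * y| ≤ 1) (by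
      intro y hy; rw [abs_le] at *; constructor <;> linarith) (fun y => t - (x + y) ^ 3 + β * (x + y)) (by fun_prop)
    refine le_trans (le_of_eq (lintegral_congr fun q => ?_)) this
    have ex : Xm β ((t, x) + q) = 1 + |q.1 + (t - (x + q.2) ^ 3 + β * (x + q.2))| := by
      unfold Xm
      simp only [Prod.fst_add, Prod.snd_add]
      congr 2; ring
    rw [ex]
  · have := strip_int r (-x/2) (fun y => |x + 2 * y| ≤ 1) (by
      intro y hy; rw [abs_le] at *; constructor <;> linarith) (fun y => - y ^ 3 + β * y) (by fun_prop)
    refine le_trans (le_of_eq (lintegral_congr fun p1 => ?_)) this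
    have ex : Xm β p1 = 1 + |p1.1 + (- p1.2 ^ 3 + β * p1.2)| := by
      unfold Xm
      congr 2; ring
    rw [ex]
  · have := strip_int r 0 (fun y => |y| ≤ 1) (by
      intro y hy; simpa using hy) (fun y => - y ^ 3 + β * y) (by fun_prop)
    refine le_trans (le_of_eq (lintegral_congr fun p1 => ?_)) this
    have ex : Xm β p1 = 1 + |p1.1 + (- p1.2 ^ 3 + β * p1.2)| := by
      unfold Xm
      congr 2; ring
    rw [ex]

end

section

open MeasureTheory

lemma lint_cs {α : Type*} [MeasurableSpace α] (μ : Measure α) {f g : α → ENNReal} (hf : Measurable f) (hg : Measurable g) :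
    (∫⁻ a, f a * g a ∂μ) ^ 2 ≤ (∫⁻ a, f a ^ 2 ∂μ) * ∫⁻ a, g a ^ 2 ∂μ := by
  have h := ENNReal.lintegral_mul_le_Lp_mul_Lq μ (p := 2) (q := 2) (by constructor <;> norm_num) hf.aemeasurable hg.aemeasurable
  have h2 := pow_le_pow_left' h 2
  simp only [Pi.mul_apply] at h2
  refine h2.trans (le_of_eq ?_)
  rw [mul_pow, ← ENNReal.rpow_natCast, ← ENNReal.rpow_natCast, ← ENNReal.rpow_mul, ← ENNReal.rpow_mul]
  norm_num

abbrev R2 := ℝ × ℝ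

lemma schur0 {S : R2 → R2 → ENNReal} (hS : Measurable (Function.uncurry S)) {κ : ENNReal}
    (hκ : ∀ p, ∫⁻ p1, S p1 (p - p1) ^ 2 ≤ κ) {h1 h2 : R2 → ENNReal} (m1 : Measurable h1) (m2 : Measurable h2) :
    ∫⁻ p, (∫⁻ p1, S p1 (p - p1) * (h1 p1 * h2 (p - p1))) ^ 2 ≤ κ * (∫⁻ p, h1 p ^ 2) * ∫⁻ p, h2 p ^ 2 := by
  have hS' : ∀ p : R2, Measurable fun p1 => S p1 (p - p1) := fun p =>
    hS.comp (by fun_prop : Measurable fun p1 : R2 => (p1, p - p1))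
  calc _ ≤ ∫⁻ p, κ * ∫⁻ p1, (h1 p1 * h2 (p - p1)) ^ 2 := by
        refine lintegral_mono fun p => ?_
        refine (lint_cs volume (hS' p) (by fun_prop)).trans ?_
        gcongr
        exact hκ p
    _ = κ * ∫⁻ p, ∫⁻ p1, (h1 p1 * h2 (p - p1)) ^ 2 := by
        rw [lintegral_const_mul]
        exact Measurable.lintegral_prod_right' (f := fun z : R2 × R2 => (h1 z.2 * h2 (z.1 - z.2)) ^ 2) (by fun_prop)
    _ = κ * ∫⁻ p1, ∫⁻ p, (h1 p1 * h2 (p - p1)) ^ 2 := by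
        rw [lintegral_lintegral_swap]
        exact (by fun_prop : Measurable fun z : R2 × R2 => (h1 z.2 * h2 (z.1 - z.2)) ^ 2).aemeasurable
    _ = κ * ∫⁻ p1, h1 p1 ^ 2 * ∫⁻ p, h2 p ^ 2 := by
        congr 1
        refine lintegral_congr fun p1 => ?_
        simp_rw [mul_pow]
        rw [lintegral_const_mul _ (by fun_prop)]
        congr 1
        exact lintegral_sub_right_eq_self (fun p => h2 p ^ 2) p1
    _ = _ := by
        rw [lintegral_mul_const _ (by fun_prop), mul_assoc]

lemma schur1 {S : R2 → R2 → ENNReal} (hS : Measurable (Function.uncurry S)) {κ : ENNReal}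
    (hκ : ∀ p1, ∫⁻ q, S p1 q ^ 2 ≤ κ) {h1 h2 : R2 → ENNReal} (m1 : Measurable h1) (m2 : Measurable h2) :
    ∫⁻ p, (∫⁻ p1, S p1 (p - p1) * (h1 p1 * h2 (p - p1))) ^ 2 ≤ κ * (∫⁻ p, h1 p ^ 2) * ∫⁻ p, h2 p ^ 2 := by
  have hS' : ∀ p : R2, Measurable fun p1 => S p1 (p - p1) := fun p =>
    hS.comp (by fun_prop : Measurable fun p1 : R2 => (p1, p - p1))
  have hS2 : Measurable fun z : R2 × R2 => S z.2 (z.1 - z.2) :=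
    hS.comp (by fun_prop : Measurable fun z : R2 × R2 => (z.2, z.1 - z.2))
  calc _ ≤ ∫⁻ p, (∫⁻ p1, S p1 (p - p1) ^ 2 * h1 p1 ^ 2) * ∫⁻ q, h2 q ^ 2 := by
        refine lintegral_mono fun p => ?_
        simp only [← mul_assoc]
        refine (lint_cs volume ((hS' p).mul m1) (by fun_prop)).trans ?_
        simp only [Pi.mul_apply, mul_pow]
        exact mul_le_mul' le_rfl (lintegral_sub_left_eq_self (μ := volume) (fun q => h2 q ^ 2) p).le
    _ = (∫⁻ p, ∫⁻ p1, S p1 (p - p1) ^ 2 * h1 p1 ^ 2) * ∫⁻ q, h2 q ^ 2 := by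
        rw [lintegral_mul_const]
        exact Measurable.lintegral_prod_right' (f := fun z : R2 × R2 => S z.2 (z.1 - z.2) ^ 2 * h1 z.2 ^ 2) (by fun_prop)
    _ = (∫⁻ p1, ∫⁻ p, S p1 (p - p1) ^ 2 * h1 p1 ^ 2) * ∫⁻ q, h2 q ^ 2 := by
        rw [lintegral_lintegral_swap]
        exact (by fun_prop : Measurable fun z : R2 × R2 => S z.2 (z.1 - z.2) ^ 2 * h1 z.2 ^ 2).aemeasurable
    _ ≤ (∫⁻ p1, κ * h1 p1 ^ 2) * ∫⁻ q, h2 q ^ 2 := by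
        gcongr with p1
        have hS3 : Measurable fun p => S p1 (p - p1) :=
          hS.comp (by fun_prop : Measurable fun p : R2 => (p1, p - p1))
        rw [lintegral_mul_const _ (by fun_prop)]
        gcongr
        refine le_trans (le_of_eq ?_) (hκ p1)
        exact lintegral_sub_right_eq_self (fun q => S p1 q ^ 2) p1
    _ = _ := by
        rw [lintegral_const_mul _ (by fun_prop)]

lemma schur2 {S : R2 → R2 → ENNReal} (hS : Measurable (Function.uncurry S)) {κ : ENNReal}
    (hκ : ∀ q, ∫⁻ p1, S p1 q ^ 2 ≤ κ) {h1 h2 : R2 → ENNReal} (m1 : Measurable h1) (m2 : Measurable h2) :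
    ∫⁻ p, (∫⁻ p1, S p1 (p - p1) * (h1 p1 * h2 (p - p1))) ^ 2 ≤ κ * (∫⁻ p, h1 p ^ 2) * ∫⁻ p, h2 p ^ 2 := by
  have h := schur1 (S := fun a b => S b a) (hS.comp measurable_swap) hκ m2 m1
  rw [mul_right_comm] at h
  refine le_trans (le_of_eq (lintegral_congr fun p => ?_)) h
  congr 1
  rw [← lintegral_sub_left_eq_self _ p]
  refine lintegral_congr fun q => ?_
  rw [sub_sub_cancel, mul_comm (h1 _)]

lemma schur_all {S0 S1 S2 : R2 → R2 → ENNReal} (hS0 : Measurable (Function.uncurry S0))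
    (hS1 : Measurable (Function.uncurry S1)) (hS2 : Measurable (Function.uncurry S2)) {κ : ENNReal}
    (hκ0 : ∀ p, ∫⁻ p1, S0 p1 (p - p1) ^ 2 ≤ κ) (hκ1 : ∀ p1, ∫⁻ q, S1 p1 q ^ 2 ≤ κ)
    (hκ2 : ∀ q, ∫⁻ p1, S2 p1 q ^ 2 ≤ κ) (c : ENNReal)
    {h1 h2 : R2 → ENNReal} (m1 : Measurable h1) (m2 : Measurable h2) {F : R2 → ENNReal}
    (hF : ∀ p, F p ≤ ∫⁻ p1, (c * (S0 p1 (p - p1) + S1 p1 (p - p1) + S2 p1 (p - p1))) * (h1 p1 * h2 (p - p1))) :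
    ∫⁻ p, F p ^ 2 ≤ (c ^ 2 * (9 * κ)) * (∫⁻ p, h1 p ^ 2) * ∫⁻ p, h2 p ^ 2 := by
  have key : ∀ S : R2 → R2 → ENNReal, Measurable (Function.uncurry S) →
      Measurable fun z : R2 × R2 => S z.2 (z.1 - z.2) * (h1 z.2 * h2 (z.1 - z.2)) := by
    intro S hS
    have hS2 : Measurable fun z : R2 × R2 => S z.2 (z.1 - z.2) :=
      hS.comp (by fun_prop : Measurable fun z : R2 × R2 => (z.2, z.1 - z.2))
    fun_prop
  have key2 : ∀ S : R2 → R2 → ENNReal, Measurable (Function.uncurry S) → ∀ p : R2,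
      Measurable fun p1 : R2 => S p1 (p - p1) * (h1 p1 * h2 (p - p1)) := by
    intro S hS p
    exact (key S hS).comp (by fun_prop : Measurable fun p1 : R2 => (p, p1))
  have key3 : ∀ S : R2 → R2 → ENNReal, Measurable (Function.uncurry S) →
      Measurable fun p : R2 => ∫⁻ p1, S p1 (p - p1) * (h1 p1 * h2 (p - p1)) := by
    intro S hS
    exact (key S hS).lintegral_prod_right'
  have n0 := key3 S0 hS0
  have n1 := key3 S1 hS1
  have n2 := key3 S2 hS2
  set I0 := fun p => ∫⁻ p1, S0 p1 (p - p1) * (h1 p1 * h2 (p - p1)) with hI0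
  set I1 := fun p => ∫⁻ p1, S1 p1 (p - p1) * (h1 p1 * h2 (p - p1)) with hI1
  set I2 := fun p => ∫⁻ p1, S2 p1 (p - p1) * (h1 p1 * h2 (p - p1)) with hI2
  have three : ∀ a b d : ENNReal, (a + b + d) ^ 2 ≤ 3 * (a ^ 2 + b ^ 2 + d ^ 2) := by
    intro a b d
    by_cases ht : a = ⊤ ∨ b = ⊤ ∨ d = ⊤
    · rcases ht with h | h | h <;> subst h <;> simp
    · push Not at ht
      obtain ⟨ha, hb, hd⟩ := ht
      lift a to NNReal using ha
      lift b to NNReal using hb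
      lift d to NNReal using hd
      norm_cast
      rw [← NNReal.coe_le_coe]
      push_cast
      nlinarith [sq_nonneg ((a:ℝ) - b), sq_nonneg ((b:ℝ) - d), sq_nonneg ((a:ℝ) - d)]
  have hF2 : ∀ p, F p ^ 2 ≤ c ^ 2 * (3 * (I0 p ^ 2 + I1 p ^ 2 + I2 p ^ 2)) := by
    intro p
    have : F p ≤ c * (I0 p + I1 p + I2 p) := by
      refine (hF p).trans (le_of_eq ?_)
      simp only [hI0, hI1, hI2]
      rw [← lintegral_add_left (key2 S0 hS0 p), ← lintegral_add_left ((key2 S0 hS0 p).fun_add (key2 S1 hS1 p)),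
        ← lintegral_const_mul _ (((key2 S0 hS0 p).fun_add (key2 S1 hS1 p)).fun_add (key2 S2 hS2 p))]
      refine lintegral_congr fun p1 => ?_
      ring
    calc F p ^ 2 ≤ (c * (I0 p + I1 p + I2 p)) ^ 2 := by gcongr
      _ = c ^ 2 * (I0 p + I1 p + I2 p) ^ 2 := mul_pow _ _ _
      _ ≤ _ := by gcongr; exact three _ _ _
  calc ∫⁻ p, F p ^ 2 ≤ ∫⁻ p, c ^ 2 * (3 * (I0 p ^ 2 + I1 p ^ 2 + I2 p ^ 2)) := lintegral_mono hF2
    _ = c ^ 2 * (3 * ((∫⁻ p, I0 p ^ 2) + (∫⁻ p, I1 p ^ 2) + (∫⁻ p, I2 p ^ 2))) := by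
        rw [lintegral_const_mul _ (by fun_prop), lintegral_const_mul _ (by fun_prop),
          lintegral_add_left (by fun_prop), lintegral_add_left (by fun_prop)]
    _ ≤ c ^ 2 * (3 * (κ * (∫⁻ p, h1 p ^ 2) * (∫⁻ p, h2 p ^ 2) + κ * (∫⁻ p, h1 p ^ 2) * (∫⁻ p, h2 p ^ 2) +
          κ * (∫⁻ p, h1 p ^ 2) * (∫⁻ p, h2 p ^ 2))) := by
        gcongr
        · exact schur0 hS0 hκ0 m1 m2
        · exact schur1 hS1 hκ1 m1 m2
        · exact schur2 hS2 hκ2 m1 m2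
    _ = _ := by ring

noncomputable def wgt (p : R2) : ℝ := 1 + |p.2| + |p.1| ^ ((1:ℝ)/3)

lemma wgt_one_le (p : R2) : 1 ≤ wgt p := by
  unfold wgt
  have := Real.rpow_nonneg (abs_nonneg p.1) (1/3)
  linarith [abs_nonneg p.2]

lemma wgt_mul (p q : R2) : wgt (p + q) ≤ wgt p * wgt q := by
  unfold wgt
  have a1 := Real.rpow_nonneg (abs_nonneg p.1) (1/3)
  have a2 := Real.rpow_nonneg (abs_nonneg q.1) (1/3)
  have b1 := abs_nonneg p.2
  have b2 := abs_nonneg q.2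
  have h1 : |(p + q).1| ^ ((1:ℝ)/3) ≤ |p.1| ^ ((1:ℝ)/3) + |q.1| ^ ((1:ℝ)/3) := by
    refine le_trans ?_ (Real.rpow_add_le_add_rpow (abs_nonneg _) (abs_nonneg _) (by norm_num) (by norm_num))
    exact Real.rpow_le_rpow (abs_nonneg _) (abs_add_le _ _) (by norm_num)
  have h2 : |(p + q).2| ≤ |p.2| + |q.2| := abs_add_le _ _
  generalize |p.1| ^ ((1:ℝ)/3) = x at *
  generalize |q.1| ^ ((1:ℝ)/3) = y at *
  nlinarith [mul_nonneg a1 a2, mul_nonneg b1 b2, mul_nonneg a1 b2, mul_nonneg b1 a2]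

lemma ind_low {ξ : ℝ} (h : |ξ| ≤ 1) : Set.indicator (Set.Icc (-1:ℝ) 1) (fun _ => (1:ℝ)) ξ = 1 :=
  Set.indicator_of_mem (show ξ ∈ Set.Icc (-1:ℝ) 1 from abs_le.1 h) _

lemma ind_high {ξ : ℝ} (h : 1 < |ξ|) : Set.indicator (Set.Icc (-1:ℝ) 1) (fun _ => (1:ℝ)) ξ = 0 :=
  Set.indicator_of_notMem (fun h' => by have := abs_le.2 h'; linarith) _

lemma ind_nonneg (ξ : ℝ) : 0 ≤ Set.indicator (Set.Icc (-1:ℝ) 1) (fun _ => (1:ℝ)) ξ :=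
  Set.indicator_nonneg (fun _ _ => zero_le_one) _

lemma nuWt_ge (b σ β : ℝ) (p : R2) : Xm β p ^ b ≤ nuWt b σ β p.1 p.2 := by
  unfold nuWt Xm
  have := mul_nonneg (ind_nonneg p.2) (Real.rpow_nonneg (show 0 ≤ 1 + |p.1| by positivity) σ)
  linarith

lemma nuWt_pos (b σ β : ℝ) (p : R2) : 0 < nuWt b σ β p.1 p.2 :=
  lt_of_lt_of_le (Real.rpow_pos_of_pos (by linarith [one_le_Xm β p]) _) (nuWt_ge b σ β p)

lemma gaWt_nonneg (b σ β : ℝ) (p : R2) : 0 ≤ gaWt b σ β p.1 p.2 := by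
  unfold gaWt
  have := mul_nonneg (ind_nonneg p.2) (Real.rpow_nonneg (show 0 ≤ 1 + |p.1| by positivity) (σ - 1))
  positivity

lemma Xm_low (β : ℝ) {p : R2} (h : |p.2| ≤ 1) : Xm β p ≤ (2 + |β|) * (1 + |p.1|) := by
  unfold Xm
  have h1 : |p.1 - p.2 ^ 3 + β * p.2| ≤ |p.1| + |p.2| ^ 3 + |β| * |p.2| := by
    rw [← abs_pow, ← abs_mul]
    exact (abs_add_le _ _).trans (add_le_add (abs_sub _ _) le_rfl)
  have h2 : |p.2| ^ 3 ≤ 1 := pow_le_one₀ (abs_nonneg _) h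
  have h3 : |β| * |p.2| ≤ |β| := mul_le_of_le_one_right (abs_nonneg _) h
  nlinarith [abs_nonneg p.1, abs_nonneg β, mul_nonneg (abs_nonneg β) (abs_nonneg p.1)]

lemma nu_high {b : ℝ} (hb : 7/16 ≤ b) (σ β : ℝ) (p : R2) :
    ((nuWt b σ β p.1 p.2) ^ 2)⁻¹ ≤ Xm β p ^ (-(7/8 : ℝ)) := by
  have hX := one_le_Xm β p
  have hX0 : 0 < Xm β p := by linarith
  rw [Real.rpow_neg hX0.le]
  apply inv_anti₀ (by positivity)
  have : Xm β p ^ (7/8 : ℝ) = (Xm β p ^ (7/16 : ℝ)) ^ 2 := by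
    rw [← Real.rpow_natCast, ← Real.rpow_mul hX0.le]; norm_num
  rw [this]
  gcongr
  exact (Real.rpow_le_rpow_of_exponent_le hX hb).trans (nuWt_ge b σ β p)

lemma nu_low (b : ℝ) {σ r : ℝ} (hr0 : 0 ≤ r) (hr : r ≤ 2 * σ) (hr2 : r ≤ 2) (β : ℝ) {p : R2} (h : |p.2| ≤ 1) :
    ((nuWt b σ β p.1 p.2) ^ 2)⁻¹ ≤ (3 + |β|) ^ 2 * Xm β p ^ (-r) := by
  have hX := one_le_Xm β p
  have hX0 : 0 < Xm β p := by linarith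
  have hν := nuWt_pos b σ β p
  have hc : 1 ≤ 3 + |β| := by linarith [abs_nonneg β]
  have ht : 1 ≤ 1 + |p.1| := by linarith [abs_nonneg p.1]
  rw [Real.rpow_neg hX0.le, ← div_eq_mul_inv, inv_le_comm₀ (by positivity) (by positivity), inv_div]
  rw [div_le_iff₀ (by positivity)]
  have h1 : Xm β p ^ r ≤ ((3 + |β|) * (1 + |p.1|)) ^ r := by
    refine Real.rpow_le_rpow hX0.le ((Xm_low β h).trans ?_) hr0
    gcongr; norm_num
  rw [Real.mul_rpow (by positivity) (by positivity)] at h1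
  have h2 : (3 + |β|) ^ r ≤ (3 + |β|) ^ 2 := by
    rw [← Real.rpow_natCast]
    exact Real.rpow_le_rpow_of_exponent_le hc (by exact_mod_cast hr2)
  have h3 : (1 + |p.1|) ^ r ≤ nuWt b σ β p.1 p.2 ^ 2 := by
    have : (1 + |p.1|) ^ r ≤ ((1 + |p.1|) ^ σ) ^ 2 := by
      rw [← Real.rpow_natCast, ← Real.rpow_mul (by positivity)]
      exact Real.rpow_le_rpow_of_exponent_le ht (by push_cast; linarith)
    refine this.trans ?_
    gcongr
    unfold nuWt
    rw [ind_low h, one_mul]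
    have := Real.rpow_nonneg (show 0 ≤ 1 + |p.1 - p.2 ^ 3 + β * p.2| by positivity) b
    linarith
  calc Xm β p ^ r ≤ _ := h1
    _ ≤ (3 + |β|) ^ 2 * nuWt b σ β p.1 p.2 ^ 2 := by gcongr
    _ = _ := mul_comm _ _

lemma ga_high {b : ℝ} (hb : 7/16 ≤ b) (σ β : ℝ) {p : R2} (h : 1 < |p.2|) :
    (gaWt b σ β p.1 p.2) ^ 2 ≤ (3 + |β|) ^ 2 * Xm β p ^ (-(7/8 : ℝ)) := by
  have hX := one_le_Xm β p
  have hX0 : 0 < Xm β p := by linarith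
  have hc : 1 ≤ (3 + |β|) ^ 2 := by nlinarith [abs_nonneg β]
  have e : gaWt b σ β p.1 p.2 = Xm β p ^ (-b) := by
    unfold gaWt Xm; rw [ind_high h, zero_mul, add_zero]
  rw [e, ← Real.rpow_natCast, ← Real.rpow_mul hX0.le]
  refine le_trans ?_ (le_mul_of_one_le_left (by positivity) hc)
  exact Real.rpow_le_rpow_of_exponent_le hX (by push_cast; linarith)

lemma ga_low {b σ : ℝ} (hb : 7/16 ≤ b) (hσ : σ ≤ 2/3) (β : ℝ) (p : R2) :
    (gaWt b σ β p.1 p.2) ^ 2 ≤ (3 + |β|) ^ 2 * Xm β p ^ (-(2/3 : ℝ)) := by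
  have hX := one_le_Xm β p
  have hX0 : 0 < Xm β p := by linarith
  have ht : 1 ≤ 1 + |p.1| := by linarith [abs_nonneg p.1]
  rcases le_or_gt |p.2| 1 with h | h
  · have e : (3 + |β|) ^ 2 * Xm β p ^ (-(2/3 : ℝ)) = ((3 + |β|) * Xm β p ^ (-(1/3 : ℝ))) ^ 2 := by
      rw [mul_pow, ← Real.rpow_natCast (Xm β p ^ (-(1/3 : ℝ))), ← Real.rpow_mul hX0.le]; norm_num
    rw [e]
    have := gaWt_nonneg b σ β p
    gcongr
    have h1 : Xm β p ^ (-b) ≤ Xm β p ^ (-(1/3 : ℝ)) := Real.rpow_le_rpow_of_exponent_le hX (by linarith)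
    have h2 : (1 + |p.1|) ^ (σ - 1) ≤ (2 + |β|) * Xm β p ^ (-(1/3 : ℝ)) := by
      calc (1 + |p.1|) ^ (σ - 1) ≤ (1 + |p.1|) ^ (-(1/3 : ℝ)) := Real.rpow_le_rpow_of_exponent_le ht (by linarith)
        _ ≤ (Xm β p / (2 + |β|)) ^ (-(1/3 : ℝ)) := by
            apply Real.rpow_le_rpow_of_nonpos (by positivity) _ (by norm_num)
            rw [div_le_iff₀ (by positivity), mul_comm]; exact Xm_low β h
        _ = (2 + |β|) ^ (1/3 : ℝ) * Xm β p ^ (-(1/3 : ℝ)) := by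
            rw [Real.div_rpow hX0.le (by positivity), Real.rpow_neg (x := 2 + |β|) (by positivity), div_inv_eq_mul, mul_comm]
        _ ≤ _ := by
            gcongr
            calc (2 + |β|) ^ (1/3 : ℝ) ≤ (2 + |β|) ^ (1 : ℝ) :=
                  Real.rpow_le_rpow_of_exponent_le (by linarith [abs_nonneg β]) (by norm_num)
              _ = _ := Real.rpow_one _
    have e2 : gaWt b σ β p.1 p.2 = Xm β p ^ (-b) + (1 + |p.1|) ^ (σ - 1) := by
      unfold gaWt Xm; rw [ind_low h, one_mul]
    rw [e2]; linarith
  · refine (ga_high hb σ β h).trans ?_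
    exact mul_le_mul_of_nonneg_left (Real.rpow_le_rpow_of_exponent_le hX (by norm_num)) (by positivity)

/-- resonance -/
lemma resonance (β : ℝ) (p q : R2) :
    3 * |(p.2 + q.2) * p.2 * q.2| ≤ Xm β (p + q) + Xm β p + Xm β q := by
  unfold Xm
  have e : 3 * |(p.2 + q.2) * p.2 * q.2| = |(p.1 - p.2 ^ 3 + β * p.2) + (q.1 - q.2 ^ 3 + β * q.2) -
      ((p + q).1 - (p + q).2 ^ 3 + β * (p + q).2)| := by
    rw [← abs_of_pos (show (0:ℝ) < 3 by norm_num), ← abs_mul]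
    simp only [abs_of_pos (show (0:ℝ) < 3 by norm_num), Prod.fst_add, Prod.snd_add]
    congr 1; ring
  rw [e]
  have h1 := abs_sub ((p.1 - p.2 ^ 3 + β * p.2) + (q.1 - q.2 ^ 3 + β * q.2)) ((p + q).1 - (p + q).2 ^ 3 + β * (p + q).2)
  have h2 := abs_add_le (p.1 - p.2 ^ 3 + β * p.2) (q.1 - q.2 ^ 3 + β * q.2)
  linarith

end

section

open MeasureTheory

lemma meas_ind : Measurable (Set.indicator (Set.Icc (-1:ℝ) 1) (fun _ => (1:ℝ))) :=
  measurable_const.indicator measurableSet_Icc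

lemma meas_nu (b σ β : ℝ) : Measurable fun p : R2 => nuWt b σ β p.1 p.2 := by
  unfold nuWt
  have := meas_ind.comp (measurable_snd : Measurable (Prod.snd : R2 → ℝ))
  simp only [Function.comp_def] at this
  fun_prop

lemma meas_ga (b σ β : ℝ) : Measurable fun p : R2 => gaWt b σ β p.1 p.2 := by
  unfold gaWt
  have := meas_ind.comp (measurable_snd : Measurable (Prod.snd : R2 → ℝ))
  simp only [Function.comp_def] at this
  fun_prop

lemma meas_wgt : Measurable wgt := by
  unfold wgt; fun_prop

noncomputable def Wx (s b σ β : ℝ) (p : R2) : ENNReal := ENNReal.ofReal (wgt p ^ s * nuWt b σ β p.1 p.2)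
noncomputable def Ay (s b σ β : ℝ) (p : R2) : ENNReal := ENNReal.ofReal (wgt p ^ s * gaWt b σ β p.1 p.2 * |p.2|)

lemma meas_Wx (s b σ β : ℝ) : Measurable (Wx s b σ β) := by
  unfold Wx
  have := meas_nu b σ β
  have := meas_wgt
  fun_prop

lemma meas_ker0 (r β : ℝ) : Measurable fun z : R2 × R2 => ker0 r (Xm β z.1) (Xm β z.2) z.1.2 z.2.2 := by
  unfold ker0
  have := meas_Xm β
  refine Measurable.add (by fun_prop) (Measurable.ite ?_ (by fun_prop) measurable_const)
  exact measurableSet_le (by fun_prop) (by fun_prop)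

lemma meas_ker1 (r β : ℝ) : Measurable fun z : R2 × R2 => ker1 r (Xm β (z.1 + z.2)) (Xm β z.2) z.1.2 z.2.2 := by
  unfold ker1
  have := meas_Xm β
  refine Measurable.add (Measurable.add (by fun_prop) (Measurable.ite ?_ (by fun_prop) measurable_const))
    (Measurable.ite ?_ (by fun_prop) measurable_const)
  · exact measurableSet_le (by fun_prop) (by fun_prop)
  · exact measurableSet_le (by fun_prop) (by fun_prop)

lemma meas_ker2 (r β : ℝ) :
    Measurable (Function.uncurry fun p q : R2 => ENNReal.ofReal √(ker1 r (Xm β (q + p)) (Xm β p) q.2 p.2)) := by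
  unfold ker1 Function.uncurry
  have := meas_Xm β
  apply Measurable.ennreal_ofReal
  apply Measurable.sqrt
  refine Measurable.add (Measurable.add (by fun_prop) (Measurable.ite ?_ (by fun_prop) measurable_const))
    (Measurable.ite ?_ (by fun_prop) measurable_const)
  · exact measurableSet_le (by fun_prop) (by fun_prop)
  · exact measurableSet_le (by fun_prop) (by fun_prop)

lemma ofReal_sqrt_sq {x : ℝ} (hx : 0 ≤ x) : ENNReal.ofReal (√x) ^ 2 = ENNReal.ofReal x := by
  rw [← ENNReal.ofReal_pow (Real.sqrt_nonneg _), Real.sq_sqrt hx]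

lemma core_pt {s b σ r : ℝ} (hs : 0 ≤ s) (hb : 7/16 ≤ b) (hσ : σ ≤ 2/3) (hr1 : 1 < r) (hr2 : r ≤ 17/16)
    (hrσ : r ≤ 2 * σ) (β : ℝ) (p q : R2) :
    Ay s b σ β (p + q) ≤ (ENNReal.ofReal (4 * (3 + |β|) ^ 2) *
      (ENNReal.ofReal √(ker0 r (Xm β p) (Xm β q) p.2 q.2) + ENNReal.ofReal √(ker1 r (Xm β (p + q)) (Xm β q) p.2 q.2) +
        ENNReal.ofReal √(ker1 r (Xm β (q + p)) (Xm β p) q.2 p.2))) * (Wx s b σ β p * Wx s b σ β q) := by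
  have n1 := nuWt_pos b σ β p
  have n2 := nuWt_pos b σ β q
  have g := gaWt_nonneg b σ β (p + q)
  have x0 := one_le_Xm β (p + q)
  have x1 := one_le_Xm β p
  have x2 := one_le_Xm β q
  have hc : 1 ≤ (3 + |β|) ^ 2 := by nlinarith [abs_nonneg β]
  rw [add_comm q p]
  have h := pt_all (r := r) (C := (3 + |β|) ^ 2) (x0 := Xm β (p + q)) (x1 := Xm β p) (x2 := Xm β q) (u1 := p.2) (u2 := q.2)
    (G := gaWt b σ β (p + q).1 (p + q).2 ^ 2) (N1 := (nuWt b σ β p.1 p.2 ^ 2)⁻¹) (N2 := (nuWt b σ β q.1 q.2 ^ 2)⁻¹)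
    hr1 hr2 hc x0 x1 x2 (resonance β p q) (by positivity) (by positivity) (by positivity)
    (ga_low hb hσ β (p + q)) (fun h => ga_high hb σ β h) (nu_high hb σ β p) (nu_high hb σ β q)
    (fun h => nu_low b (by linarith) hrσ (by linarith) β h) (fun h => nu_low b (by linarith) hrσ (by linarith) β h)
  have k0 : 0 ≤ ker0 r (Xm β p) (Xm β q) p.2 q.2 := ker0_nonneg (by linarith) (by linarith)
  have k1 : 0 ≤ ker1 r (Xm β (p + q)) (Xm β q) p.2 q.2 := ker1_nonneg (by linarith) (by linarith)
  have k2 : 0 ≤ ker1 r (Xm β (p + q)) (Xm β p) q.2 p.2 := ker1_nonneg (by linarith) (by linarith)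
  generalize ker0 r (Xm β p) (Xm β q) p.2 q.2 = K0 at *
  generalize ker1 r (Xm β (p + q)) (Xm β q) p.2 q.2 = K1 at *
  generalize ker1 r (Xm β (p + q)) (Xm β p) q.2 p.2 = K2 at *
  unfold Ay Wx
  have w1 := wgt_one_le p
  have w2 := wgt_one_le q
  have w0 := wgt_one_le (p + q)
  rw [← ENNReal.ofReal_add (by positivity) (by positivity), ← ENNReal.ofReal_add (by positivity) (by positivity),
    ← ENNReal.ofReal_mul (by positivity), ← ENNReal.ofReal_mul (by positivity), ← ENNReal.ofReal_mul (by positivity)]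
  apply ENNReal.ofReal_le_ofReal
  have hw : wgt (p + q) ^ s ≤ wgt p ^ s * wgt q ^ s := by
    rw [← Real.mul_rpow (by linarith) (by linarith)]
    exact Real.rpow_le_rpow (by linarith) (wgt_mul p q) hs
  have hk : gaWt b σ β (p + q).1 (p + q).2 * |(p + q).2| ≤
      (4 * (3 + |β|) ^ 2 * (√K0 + √K1 + √K2)) * (nuWt b σ β p.1 p.2 * nuWt b σ β q.1 q.2) := by
    rw [← div_le_iff₀ (by positivity)]
    refine le_of_sq_le_sq ?_ (by positivity)
    have s0 := Real.sq_sqrt k0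
    have s1 := Real.sq_sqrt k1
    have s2 := Real.sq_sqrt k2
    have : K0 + K1 + K2 ≤ (√K0 + √K1 + √K2) ^ 2 := by
      nlinarith [mul_nonneg (Real.sqrt_nonneg K0) (Real.sqrt_nonneg K1), mul_nonneg (Real.sqrt_nonneg K0) (Real.sqrt_nonneg K2), mul_nonneg (Real.sqrt_nonneg K1) (Real.sqrt_nonneg K2)]
    calc _ = (p.2 + q.2) ^ 2 * (gaWt b σ β (p + q).1 (p + q).2 ^ 2 * ((nuWt b σ β p.1 p.2 ^ 2)⁻¹ * (nuWt b σ β q.1 q.2 ^ 2)⁻¹)) := by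
          rw [div_pow, mul_pow, sq_abs, Prod.snd_add]
          field_simp
      _ ≤ _ := h
      _ ≤ 16 * ((3 + |β|) ^ 2) ^ 2 * (√K0 + √K1 + √K2) ^ 2 := by gcongr
      _ = _ := by ring
  calc _ = wgt (p + q) ^ s * (gaWt b σ β (p + q).1 (p + q).2 * |(p + q).2|) := by ring
    _ ≤ (wgt p ^ s * wgt q ^ s) * ((4 * (3 + |β|) ^ 2 * (√K0 + √K1 + √K2)) * (nuWt b σ β p.1 p.2 * nuWt b σ β q.1 q.2)) := by
        gcongr
    _ = _ := by ring

theorem core {s b σ : ℝ} (hs : 0 ≤ s) (hb : 7/16 ≤ b) (hσ1 : 1/2 < σ) (hσ : σ ≤ 2/3) (β : ℝ) :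
    ∃ C : ENNReal, C ≠ ⊤ ∧ ∀ f1 f2 : R2 → ENNReal, Measurable f1 → Measurable f2 →
      ∫⁻ p, (Ay s b σ β p * ∫⁻ p1, f1 p1 * f2 (p - p1)) ^ 2 ≤
        C * (∫⁻ p, (Wx s b σ β p * f1 p) ^ 2) * ∫⁻ p, (Wx s b σ β p * f2 p) ^ 2 := by
  obtain ⟨r, hr1, hr2, hrσ⟩ : ∃ r : ℝ, 1 < r ∧ r ≤ 17/16 ∧ r ≤ 2 * σ :=
    ⟨min (2 * σ) (17/16), lt_min (by linarith) (by norm_num), min_le_right _ _, min_le_left _ _⟩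
  have hk := (kap_lt_top hr1).ne
  obtain ⟨κ, hκ⟩ : ∃ κ : ENNReal, κ = kap r * (2 * kap r) + (2 * kap r + 2 * kap r) + 2 * kap r := ⟨_, rfl⟩
  have hκt : κ ≠ ⊤ := by
    have h2 : 2 * kap r ≠ ⊤ := ENNReal.mul_ne_top (by simp) hk
    rw [hκ]
    exact ENNReal.add_ne_top.2 ⟨ENNReal.add_ne_top.2 ⟨ENNReal.mul_ne_top hk h2, ENNReal.add_ne_top.2 ⟨h2, h2⟩⟩, h2⟩
  refine ⟨(ENNReal.ofReal (4 * (3 + |β|) ^ 2)) ^ 2 * (9 * κ), ?_, ?_⟩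
  · exact ENNReal.mul_ne_top (ENNReal.pow_ne_top ENNReal.ofReal_ne_top) (ENNReal.mul_ne_top (by simp) hκt)
  intro f1 f2 m1 m2
  have mW := meas_Wx s b σ β
  have pos : ∀ q, 0 ≤ Xm β q := fun q => zero_le_one.trans (one_le_Xm β q)
  have M0 : Measurable (Function.uncurry fun p q : R2 => ENNReal.ofReal √(ker0 r (Xm β p) (Xm β q) p.2 q.2)) :=
    (meas_ker0 r β).sqrt.ennreal_ofReal
  have M1 : Measurable (Function.uncurry fun p q : R2 => ENNReal.ofReal √(ker1 r (Xm β (p + q)) (Xm β q) p.2 q.2)) :=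
    (meas_ker1 r β).sqrt.ennreal_ofReal
  have M2 : Measurable (Function.uncurry fun p q : R2 => ENNReal.ofReal √(ker1 r (Xm β (q + p)) (Xm β p) q.2 p.2)) :=
    meas_ker2 r β
  have K0 : ∀ p : R2, ∫⁻ p1 : R2, ENNReal.ofReal √(ker0 r (Xm β p1) (Xm β (p - p1)) p1.2 (p - p1).2) ^ 2 ≤ κ := by
    intro p
    simp_rw [ofReal_sqrt_sq (ker0_nonneg (pos _) (pos _))]
    exact hκ ▸ (ker0_int r β p).trans le_self_add
  have K1 : ∀ p : R2, ∫⁻ q : R2, ENNReal.ofReal √(ker1 r (Xm β (p + q)) (Xm β q) p.2 q.2) ^ 2 ≤ κ := by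
    intro p
    simp_rw [ofReal_sqrt_sq (ker1_nonneg (pos _) (pos _))]
    exact hκ ▸ ker1_int r β p
  have H := fun (F : R2 → ENNReal) => schur_all M0 M1 M2 K0 K1 K1 (ENNReal.ofReal (4 * (3 + |β|) ^ 2))
    (h1 := fun p => Wx s b σ β p * f1 p) (h2 := fun p => Wx s b σ β p * f2 p) (mW.mul m1) (mW.mul m2) (F := F)
  refine H _ ?_
  intro p
  rw [← lintegral_const_mul _ (by fun_prop)]
  refine lintegral_mono fun p1 => ?_
  have h := core_pt hs hb hσ hr1 hr2 hrσ β p1 (p - p1)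
  rw [show Ay s b σ β (p1 + (p - p1)) = Ay s b σ β p by rw [add_sub_cancel]] at h
  refine (mul_le_mul' h le_rfl).trans ?_
  generalize ENNReal.ofReal (4 * (3 + |β|) ^ 2) = c0
  generalize ENNReal.ofReal √(ker0 r (Xm β p1) (Xm β (p - p1)) p1.2 (p - p1).2) = c1
  generalize ENNReal.ofReal √(ker1 r (Xm β (p1 + (p - p1))) (Xm β (p - p1)) p1.2 (p - p1).2) = c2
  generalize ENNReal.ofReal √(ker1 r (Xm β (p - p1 + p1)) (Xm β p1) (p - p1).2 p1.2) = c3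
  exact le_of_eq (by ring)

end

section

open MeasureTheory

lemma sqrt_ennreal (x : ENNReal) : (x ^ (1/2 : ℝ)) ^ 2 = x := by
  rw [← ENNReal.rpow_natCast, ← ENNReal.rpow_mul]; norm_num

lemma conv_tau {K : ℝ → ENNReal} (mK : Measurable K) {h : R2 → ENNReal} (mh : Measurable h) :
    ∫⁻ p : R2, (∫⁻ η, K η * h (p - (2 * Real.pi * η, 0))) ^ 2 ≤ (∫⁻ η, K η) ^ 2 * ∫⁻ p, h p ^ 2 := by
  have mz : Measurable fun z : R2 × ℝ => K z.2 * h (z.1 - (2 * Real.pi * z.2, 0)) ^ 2 := by fun_prop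
  calc _ ≤ ∫⁻ p : R2, (∫⁻ η, K η) * ∫⁻ η, K η * h (p - (2 * Real.pi * η, 0)) ^ 2 := by
        refine lintegral_mono fun p => ?_
        have := lint_cs (volume : Measure ℝ) (f := fun η => K η ^ (1/2 : ℝ)) (g := fun η => K η ^ (1/2 : ℝ) * h (p - (2 * Real.pi * η, 0)))
          (by fun_prop) (by fun_prop)
        simp only [mul_pow, sqrt_ennreal, ← mul_assoc, ← pow_two] at this
        exact this
    _ = (∫⁻ η, K η) * ∫⁻ p : R2, ∫⁻ η, K η * h (p - (2 * Real.pi * η, 0)) ^ 2 := by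
        rw [lintegral_const_mul]
        exact mz.lintegral_prod_right'
    _ = (∫⁻ η, K η) * ∫⁻ η, ∫⁻ p : R2, K η * h (p - (2 * Real.pi * η, 0)) ^ 2 := by
        rw [lintegral_lintegral_swap]
        exact mz.aemeasurable
    _ = (∫⁻ η, K η) * ∫⁻ η, K η * ∫⁻ p : R2, h p ^ 2 := by
        congr 1
        refine lintegral_congr fun η => ?_
        rw [lintegral_const_mul _ (by fun_prop)]
        congr 1
        exact lintegral_sub_right_eq_self (μ := volume) (fun p => h p ^ 2) ((2 * Real.pi * η, 0) : R2)
    _ = _ := by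
        rw [lintegral_mul_const _ mK]; ring

noncomputable def mfac (s η : ℝ) : ℝ := wgt (η, 0) ^ s * (1 + |η|)

lemma rpow_shift {x y z a : ℝ} (hx : 1 ≤ x) (hy : 0 ≤ y) (hz : 0 ≤ z) (h : z ≤ x * y) (ha : 0 ≤ a) (ha1 : a ≤ 1) :
    z ^ a ≤ x * y ^ a := by
  calc z ^ a ≤ (x * y) ^ a := Real.rpow_le_rpow hz h ha
    _ = x ^ a * y ^ a := Real.mul_rpow (by linarith) hy
    _ ≤ x ^ (1:ℝ) * y ^ a := by
        gcongr
    _ = _ := by rw [Real.rpow_one]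

lemma abs_shift (L η : ℝ) : 1 + |L| ≤ (1 + |η|) * (1 + |L - η|) := by
  have : |L| ≤ |L - η| + |η| := by simpa using abs_add_le (L - η) η
  nlinarith [abs_nonneg (L - η), abs_nonneg η, mul_nonneg (abs_nonneg (L - η)) (abs_nonneg η)]

lemma nu_shift {b σ : ℝ} (hb0 : 0 ≤ b) (hb1 : b ≤ 1) (hσ0 : 0 ≤ σ) (hσ1 : σ ≤ 1) (β : ℝ) (p : R2) (η : ℝ) :
    nuWt b σ β p.1 p.2 ≤ (1 + |η|) * nuWt b σ β (p.1 - η) p.2 := by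
  unfold nuWt
  rw [mul_add]
  have h1 : 1 ≤ 1 + |η| := by linarith [abs_nonneg η]
  refine add_le_add ?_ ?_
  · refine rpow_shift h1 (by positivity) (by positivity) ?_ hb0 hb1
    have := abs_shift (p.1 - p.2 ^ 3 + β * p.2) η
    rwa [show p.1 - p.2 ^ 3 + β * p.2 - η = p.1 - η - p.2 ^ 3 + β * p.2 by ring] at this
  · rw [mul_left_comm]
    refine mul_le_mul_of_nonneg_left ?_ (ind_nonneg _)
    exact rpow_shift h1 (by positivity) (by positivity) (abs_shift _ _) hσ0 hσ1

lemma Wx_shift {s b σ : ℝ} (hs : 0 ≤ s) (hb0 : 0 ≤ b) (hb1 : b ≤ 1) (hσ0 : 0 ≤ σ) (hσ1 : σ ≤ 1) (β : ℝ) (p : R2) (η : ℝ) :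
    Wx s b σ β p ≤ ENNReal.ofReal (mfac s η) * Wx s b σ β (p - (η, 0)) := by
  have w1 := wgt_one_le ((η, 0) : R2)
  have w2 := wgt_one_le (p - (η, 0))
  have w3 := wgt_one_le p
  unfold Wx mfac
  rw [← ENNReal.ofReal_mul (by positivity)]
  apply ENNReal.ofReal_le_ofReal
  have h1 : wgt p ^ s ≤ wgt (η, 0) ^ s * wgt (p - (η, 0)) ^ s := by
    rw [← Real.mul_rpow (by linarith) (by linarith)]
    refine Real.rpow_le_rpow (by linarith) ?_ hs
    have := wgt_mul ((η, 0) : R2) (p - (η, 0))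
    rwa [add_sub_cancel] at this
  have h2 := nu_shift hb0 hb1 hσ0 hσ1 β p η
  have e1 : (p - (η, 0)).1 = p.1 - η := rfl
  have e2 : (p - (η, 0)).2 = p.2 := by simp
  rw [e1, e2]
  have h3 := (nuWt_pos b σ β p).le
  calc _ ≤ (wgt (η, 0) ^ s * wgt (p - (η, 0)) ^ s) * ((1 + |η|) * nuWt b σ β (p.1 - η) p.2) := by gcongr
    _ = _ := by ring

lemma meas_mfac (s : ℝ) : Measurable (mfac s) := by
  unfold mfac wgt; fun_prop

lemma psi_bound {s b σ : ℝ} (hs : 0 ≤ s) (hb0 : 0 ≤ b) (hb1 : b ≤ 1) (hσ0 : 0 ≤ σ) (hσ1 : σ ≤ 1) (β : ℝ)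
    {k : ℝ → ENNReal} (mk : Measurable k) {f : R2 → ENNReal} (mf : Measurable f) :
    ∫⁻ p : R2, (Wx s b σ β p * ∫⁻ η, k η * f (p - (2 * Real.pi * η, 0))) ^ 2 ≤
      (∫⁻ η, k η * ENNReal.ofReal (mfac s (2 * Real.pi * η))) ^ 2 * ∫⁻ p, (Wx s b σ β p * f p) ^ 2 := by
  have mW := meas_Wx s b σ β
  have mm := meas_mfac s
  refine le_trans (lintegral_mono fun p => ?_) (conv_tau (K := fun η => k η * ENNReal.ofReal (mfac s (2 * Real.pi * η)))
    (h := fun p => Wx s b σ β p * f p) (by fun_prop) (by fun_prop))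
  gcongr
  rw [← lintegral_const_mul _ (by fun_prop)]
  refine lintegral_mono fun η => ?_
  calc _ ≤ (ENNReal.ofReal (mfac s (2 * Real.pi * η)) * Wx s b σ β (p - (2 * Real.pi * η, 0))) * (k η * f (p - (2 * Real.pi * η, 0))) := by
        gcongr
        exact Wx_shift hs hb0 hb1 hσ0 hσ1 β p (2 * Real.pi * η)
    _ = _ := by ring

end

section

open MeasureTheory
open scoped SchwartzMap FourierTransform

/-- Fourier transform of a product with a superposition of characters. -/
lemma FT2_conv {A : Type*} [MeasurableSpace A] (μ : Measure A) [SFinite μ] {φ : A → R2} (hφ : Measurable φ)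
    {M : A → ℂ} (hM : Integrable M μ) {G : R2 → ℂ} (hG : Integrable G) {u : R2 → ℂ}
    (hu : ∀ q : R2, u q = ∫ a, Complex.exp (Complex.I * (q.1 * (φ a).1 + q.2 * (φ a).2)) * M a ∂μ) (p : R2) :
    FT2 (fun q => u q * G q) p.1 p.2 = ∫ a, M a * FT2 G (p - φ a).1 (p - φ a).2 ∂μ := by
  unfold FT2
  have h1 : ∀ q : R2, Complex.exp (-(Complex.I * (q.1 * p.1 + q.2 * p.2))) * (u q * G q) =
      ∫ a, Complex.exp (-(Complex.I * (q.1 * (p - φ a).1 + q.2 * (p - φ a).2))) * (M a * G q) ∂μ := by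
    intro q
    rw [hu, ← integral_mul_const, ← integral_const_mul]
    refine integral_congr_ae (Filter.Eventually.of_forall fun a => ?_)
    have : Complex.exp (-(Complex.I * (q.1 * (p - φ a).1 + q.2 * (p - φ a).2))) =
        Complex.exp (-(Complex.I * (q.1 * p.1 + q.2 * p.2))) * Complex.exp (Complex.I * (q.1 * (φ a).1 + q.2 * (φ a).2)) := by
      rw [← Complex.exp_add]
      congr 1
      simp only [Prod.fst_sub, Prod.snd_sub]
      push_cast
      ring
    simp only [this]
    ring
  simp_rw [h1]
  rw [integral_integral_swap]
  · refine integral_congr_ae (Filter.Eventually.of_forall fun a => ?_)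
    simp only
    rw [← integral_const_mul]
    refine integral_congr_ae (Filter.Eventually.of_forall fun q => ?_)
    simp only
    ring
  · have hi : Integrable (fun z : R2 × A => M z.2 * G z.1) ((volume : Measure R2).prod μ) := by
      have := hG.mul_prod hM
      simpa only [mul_comm] using this
    refine hi.bdd_mul (c := 1) ?_ ?_
    · apply Measurable.aestronglyMeasurable
      fun_prop
    · refine Filter.Eventually.of_forall fun z => ?_
      rw [Complex.norm_exp]
      apply le_of_eq
      rw [Real.exp_eq_one_iff]
      simp

abbrev E2 := WithLp 2 (ℝ × ℝ)

lemma four (v : 𝓢(R2, ℂ)) : ∃ U : 𝓢(R2, ℂ), (∀ p : R2, U p = FT2 v (2 * Real.pi * p.1) (2 * Real.pi * p.2)) ∧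
    ∀ q : R2, v q = ∫ p : R2, Complex.exp (Complex.I * (q.1 * ((2 * Real.pi * p.1 : ℝ) : ℂ) + q.2 * ((2 * Real.pi * p.2 : ℝ) : ℂ))) * U p := by
  let e : E2 ≃L[ℝ] R2 := WithLp.prodContinuousLinearEquiv 2 ℝ ℝ ℝ
  have hmp : MeasurePreserving (e : E2 → R2) := WithLp.volume_preserving_ofLp ℝ ℝ
  have hemb : MeasurableEmbedding (e : E2 → R2) := e.toHomeomorph.measurableEmbedding
  let w : 𝓢(E2, ℂ) := SchwartzMap.compCLMOfContinuousLinearEquiv ℂ e v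
  have hin : ∀ x y : E2, inner ℝ x y = (e x).1 * (e y).1 + (e x).2 * (e y).2 := by
    intro x y
    rw [WithLp.prod_inner_apply]
    simp [e, mul_comm]
  refine ⟨SchwartzMap.compCLMOfContinuousLinearEquiv ℂ e.symm (𝓕 w), ?_, ?_⟩
  · intro p
    have h1 : (SchwartzMap.compCLMOfContinuousLinearEquiv ℂ e.symm (𝓕 w)) p = 𝓕 (w : E2 → ℂ) (e.symm p) := rfl
    rw [h1, Real.fourier_eq']
    unfold FT2
    rw [← hmp.integral_comp hemb]
    refine integral_congr_ae (Filter.Eventually.of_forall fun y => ?_)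
    simp only [smul_eq_mul]
    rw [hin, e.apply_symm_apply]
    have : w y = v (e y) := rfl
    rw [this]
    congr 2
    push_cast
    ring
  · intro q
    have h0 : v q = w (e.symm q) := by
      have : w (e.symm q) = v (e (e.symm q)) := rfl
      rw [this, e.apply_symm_apply]
    have h1 : w (e.symm q) = 𝓕⁻ (𝓕 (w : E2 → ℂ)) (e.symm q) := by
      rw [w.continuous.fourierInv_fourier_eq w.integrable (𝓕 w).integrable]
    rw [h0, h1, Real.fourierInv_eq', ← hmp.integral_comp hemb]
    refine integral_congr_ae (Filter.Eventually.of_forall fun y => ?_)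
    simp only [smul_eq_mul]
    rw [hin, e.apply_symm_apply]
    have : (SchwartzMap.compCLMOfContinuousLinearEquiv ℂ e.symm (𝓕 w)) (e y) = 𝓕 (w : E2 → ℂ) (e.symm (e y)) := rfl
    rw [this, e.symm_apply_apply]
    congr 2
    push_cast
    ring

lemma four2 : ∃ c : ℝ, ∀ v : 𝓢(R2, ℂ), ∃ V : 𝓢(R2, ℂ), (∀ p : R2, V p = FT2 v p.1 p.2) ∧
    ∀ q : R2, v q = ∫ p : R2, Complex.exp (Complex.I * (q.1 * (p.1 : ℂ) + q.2 * (p.2 : ℂ))) * (c * V p) := by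
  refine ⟨|(((2 * Real.pi) ^ 2)⁻¹)|, fun v => ?_⟩
  obtain ⟨U, h1, h2⟩ := four v
  have hpi : (2 * Real.pi)⁻¹ ≠ 0 := by positivity
  let e : R2 ≃L[ℝ] R2 := ContinuousLinearEquiv.smulLeft (Units.mk0 _ hpi)
  have he : ∀ p, e p = (2 * Real.pi)⁻¹ • p := fun p => rfl
  have hV : ∀ p : R2, (SchwartzMap.compCLMOfContinuousLinearEquiv ℂ e U) p = U ((2 * Real.pi)⁻¹ • p) := fun p => rfl
  refine ⟨SchwartzMap.compCLMOfContinuousLinearEquiv ℂ e U, ?_, ?_⟩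
  · intro p
    rw [hV, h1]
    simp only [Prod.smul_fst, Prod.smul_snd, smul_eq_mul]
    rw [mul_inv_cancel_left₀ (by positivity), mul_inv_cancel_left₀ (by positivity)]
  · intro q
    rw [h2 q]
    have := Measure.integral_comp_smul (volume : Measure R2) (fun p : R2 => Complex.exp (Complex.I * (q.1 * (p.1 : ℂ) + q.2 * (p.2 : ℂ))) * U ((2 * Real.pi)⁻¹ • p)) (2 * Real.pi)
    simp only [Prod.smul_fst, Prod.smul_snd, smul_eq_mul] at this
    simp only [inv_smul_smul₀ (show (2 * Real.pi) ≠ 0 by positivity), Module.finrank_prod, Module.finrank_self] at this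
    rw [this, Complex.real_smul, ← integral_const_mul]
    refine integral_congr_ae (Filter.Eventually.of_forall fun p => ?_)
    simp only [hV]
    norm_num
    ring

end

section

open MeasureTheory
open scoped SchwartzMap FourierTransform

lemma psi_inv {ψ : ℝ → ℝ} (hs : ContDiff ℝ (⊤ : ℕ∞) ψ) (hsupp : Function.support ψ ⊆ Set.Icc (-2) 2) :
    ∃ Ψ : 𝓢(ℝ, ℂ), ∀ t : ℝ, (ψ t : ℂ) = ∫ η : ℝ, Complex.exp (Complex.I * (t * ((2 * Real.pi * η : ℝ) : ℂ))) * Ψ η := by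
  have hc : HasCompactSupport (fun t => (ψ t : ℂ)) := by
    refine HasCompactSupport.of_support_subset_isCompact (isCompact_Icc (a := (-2:ℝ)) (b := 2)) ?_
    intro t ht
    apply hsupp
    simpa using ht
  have hd : ContDiff ℝ (⊤ : ℕ∞) (fun t => (ψ t : ℂ)) := Complex.ofRealCLM.contDiff.comp hs
  let w : 𝓢(ℝ, ℂ) := hc.toSchwartzMap hd
  refine ⟨𝓕 w, fun t => ?_⟩
  have h0 : (ψ t : ℂ) = w t := rfl
  have h1 : w t = 𝓕⁻ (𝓕 (w : ℝ → ℂ)) t := by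
    rw [w.continuous.fourierInv_fourier_eq w.integrable (𝓕 w).integrable]
  rw [h0, h1, Real.fourierInv_eq']
  refine integral_congr_ae (Filter.Eventually.of_forall fun y => ?_)
  have : (𝓕 w) y = 𝓕 (w : ℝ → ℂ) y := rfl
  simp only [smul_eq_mul, this]
  congr 2
  simp
  ring

lemma schw_bdd {E : Type*} [NormedAddCommGroup E] [NormedSpace ℝ E] (f : 𝓢(E, ℂ)) : ∃ B : ℝ, 0 ≤ B ∧ ∀ x, ‖f x‖ ≤ B := by
  refine ⟨SchwartzMap.seminorm ℝ 0 0 f, apply_nonneg _ _, fun x => ?_⟩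
  exact SchwartzMap.norm_le_seminorm ℝ f x

lemma schw_fin {E : Type*} [NormedAddCommGroup E] [NormedSpace ℝ E] [MeasurableSpace E] [BorelSpace E]
    [SecondCountableTopology E] (μ : Measure E) [μ.HasTemperateGrowth] (f : 𝓢(E, ℂ)) (C : ℝ) (k : ℕ) :
    ∫⁻ x, ENNReal.ofReal (C * (1 + ‖x‖) ^ k) * ‖f x‖ₑ ∂μ < ⊤ := by
  have h : Integrable (fun x => |C| * 2 ^ k * (‖x‖ ^ 0 * ‖f x‖ + ‖x‖ ^ k * ‖f x‖)) μ :=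
    ((f.integrable_pow_mul μ 0).add (f.integrable_pow_mul μ k)).const_mul _
  refine lt_of_le_of_lt (lintegral_mono fun x => ?_) h.lintegral_lt_top
  rw [← ofReal_norm, ← ENNReal.ofReal_mul' (norm_nonneg _)]
  apply ENNReal.ofReal_le_ofReal
  have h1 : (1 + ‖x‖) ^ k ≤ 2 ^ k * (1 + ‖x‖ ^ k) := by
    rcases le_total ‖x‖ 1 with hx | hx
    · calc (1 + ‖x‖) ^ k ≤ (2:ℝ) ^ k := pow_le_pow_left₀ (by positivity) (by linarith) k
        _ ≤ _ := le_mul_of_one_le_right (by positivity) (by linarith [pow_nonneg (norm_nonneg x) k])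
    · calc (1 + ‖x‖) ^ k ≤ (2 * ‖x‖) ^ k := pow_le_pow_left₀ (by positivity) (by linarith) k
        _ = 2 ^ k * ‖x‖ ^ k := mul_pow _ _ _
        _ ≤ _ := by gcongr; linarith
  calc C * (1 + ‖x‖) ^ k * ‖f x‖ ≤ |C| * (2 ^ k * (1 + ‖x‖ ^ k)) * ‖f x‖ := by
        gcongr; exact le_abs_self C
    _ = _ := by ring

lemma wgt_le (p : R2) : wgt p ≤ 2 * (1 + ‖p‖) := by
  unfold wgt
  have h1 : |p.1| ≤ ‖p‖ := norm_fst_le p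
  have h2 : |p.2| ≤ ‖p‖ := norm_snd_le p
  have h3 : |p.1| ^ ((1:ℝ)/3) ≤ 1 + ‖p‖ := by
    calc |p.1| ^ ((1:ℝ)/3) ≤ (1 + ‖p‖) ^ ((1:ℝ)/3) := Real.rpow_le_rpow (abs_nonneg _) (by linarith) (by norm_num)
      _ ≤ (1 + ‖p‖) ^ (1:ℝ) := Real.rpow_le_rpow_of_exponent_le (by linarith [norm_nonneg p]) (by norm_num)
      _ = _ := Real.rpow_one _
  linarith

lemma wgt_pow_le {s : ℝ} (hs : 0 ≤ s) (p : R2) : wgt p ^ s ≤ 2 ^ ⌈s⌉₊ * (1 + ‖p‖) ^ ⌈s⌉₊ := by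
  have w := wgt_one_le p
  calc wgt p ^ s ≤ wgt p ^ (⌈s⌉₊ : ℝ) := Real.rpow_le_rpow_of_exponent_le w (Nat.le_ceil s)
    _ = wgt p ^ ⌈s⌉₊ := Real.rpow_natCast _ _
    _ ≤ (2 * (1 + ‖p‖)) ^ ⌈s⌉₊ := pow_le_pow_left₀ (by linarith) (wgt_le p) _
    _ = _ := mul_pow _ _ _

lemma mfac_le {s : ℝ} (hs : 0 ≤ s) (η : ℝ) :
    mfac s (2 * Real.pi * η) ≤ (2 ^ ⌈s⌉₊ * 8 ^ (⌈s⌉₊ + 1)) * (1 + ‖η‖) ^ (⌈s⌉₊ + 1) := by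
  unfold mfac
  have e : ‖((2 * Real.pi * η, 0) : R2)‖ = 2 * Real.pi * ‖η‖ := by
    rw [Prod.norm_def]
    simp [Real.pi_pos.le, abs_of_pos Real.pi_pos]
    positivity
  have e2 : |2 * Real.pi * η| = 2 * Real.pi * ‖η‖ := by
    rw [abs_mul, abs_of_pos (by positivity), Real.norm_eq_abs]
  have h := wgt_pow_le hs ((2 * Real.pi * η, 0) : R2)
  rw [e] at h
  rw [e2]
  have h8 : 1 + 2 * Real.pi * ‖η‖ ≤ 8 * (1 + ‖η‖) := by nlinarith [Real.pi_lt_four, norm_nonneg η]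
  have hp : 0 ≤ 1 + 2 * Real.pi * ‖η‖ := by positivity
  calc _ ≤ (2 ^ ⌈s⌉₊ * (8 * (1 + ‖η‖)) ^ ⌈s⌉₊) * (8 * (1 + ‖η‖)) := by
        refine mul_le_mul (h.trans ?_) h8 hp (by positivity)
        gcongr
    _ = _ := by rw [mul_pow]; ring

lemma nu_le {b σ : ℝ} (hb0 : 0 ≤ b) (hb1 : b ≤ 1) (hσ0 : 0 ≤ σ) (hσ1 : σ ≤ 1) (β : ℝ) (p : R2) :
    nuWt b σ β p.1 p.2 ≤ (3 + |β|) * (1 + ‖p‖) ^ 3 := by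
  have h1 : |p.1| ≤ ‖p‖ := norm_fst_le p
  have h2 : |p.2| ≤ ‖p‖ := norm_snd_le p
  have hn := norm_nonneg p
  have pw : ∀ x a : ℝ, 1 ≤ x → a ≤ 1 → x ^ a ≤ x := fun x a hx ha => by
    simpa using Real.rpow_le_rpow_of_exponent_le hx ha
  unfold nuWt
  have hL : |p.1 - p.2 ^ 3 + β * p.2| ≤ |p.1| + |p.2| ^ 3 + |β| * |p.2| := by
    rw [← abs_pow, ← abs_mul]
    exact (abs_add_le _ _).trans (add_le_add (abs_sub _ _) le_rfl)
  have h3 : |p.2| ^ 3 ≤ ‖p‖ ^ 3 := pow_le_pow_left₀ (abs_nonneg _) h2 3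
  have h4 : |β| * |p.2| ≤ |β| * ‖p‖ := mul_le_mul_of_nonneg_left h2 (abs_nonneg _)
  have i1 : Set.indicator (Set.Icc (-1:ℝ) 1) (fun _ => (1:ℝ)) p.2 ≤ 1 :=
    Set.indicator_le' (fun _ _ => le_rfl) (fun _ _ => zero_le_one) _
  have a1 := pw (1 + |p.1 - p.2 ^ 3 + β * p.2|) b (by linarith [abs_nonneg (p.1 - p.2 ^ 3 + β * p.2)]) hb1
  have a2 := pw (1 + |p.1|) σ (by linarith [abs_nonneg p.1]) hσ1
  have a3 : Set.indicator (Set.Icc (-1:ℝ) 1) (fun _ => (1:ℝ)) p.2 * (1 + |p.1|) ^ σ ≤ 1 + ‖p‖ := by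
    calc _ ≤ 1 * (1 + |p.1|) ^ σ := mul_le_mul_of_nonneg_right i1 (by positivity)
      _ ≤ _ := by linarith
  have hb := abs_nonneg β
  have hbn := mul_nonneg hb hn
  have : (1 + ‖p‖) ^ 3 = 1 + 3 * ‖p‖ + 3 * ‖p‖ ^ 2 + ‖p‖ ^ 3 := by ring
  nlinarith [mul_nonneg hb (sq_nonneg ‖p‖), mul_nonneg hb (pow_nonneg hn 3), pow_nonneg hn 3, sq_nonneg ‖p‖]

lemma X_fin {s b σ : ℝ} (hs : 0 ≤ s) (hb0 : 0 ≤ b) (hb1 : b ≤ 1) (hσ0 : 0 ≤ σ) (hσ1 : σ ≤ 1) (β : ℝ) (V : 𝓢(R2, ℂ)) :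
    ∫⁻ p, (Wx s b σ β p * ‖V p‖ₑ) ^ 2 < ⊤ := by
  obtain ⟨B, hB0, hB⟩ := schw_bdd V
  refine lt_of_le_of_lt (lintegral_mono fun p => ?_)
    (schw_fin (volume : Measure R2) V (B * (2 ^ ⌈s⌉₊ * (3 + |β|)) ^ 2) (2 * (⌈s⌉₊ + 3)))
  have w := wgt_one_le p
  have n := (nuWt_pos b σ β p).le
  have h1 := wgt_pow_le hs p
  have h2 := nu_le hb0 hb1 hσ0 hσ1 β p
  unfold Wx
  rw [← ofReal_norm, ← ENNReal.ofReal_mul (by positivity), ← ENNReal.ofReal_mul (by positivity),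
    ← ENNReal.ofReal_pow (by positivity)]
  apply ENNReal.ofReal_le_ofReal
  calc _ = (wgt p ^ s * nuWt b σ β p.1 p.2) ^ 2 * ‖V p‖ * ‖V p‖ := by ring
    _ ≤ ((2 ^ ⌈s⌉₊ * (1 + ‖p‖) ^ ⌈s⌉₊) * ((3 + |β|) * (1 + ‖p‖) ^ 3)) ^ 2 * B * ‖V p‖ := by
        gcongr
        exact hB p
    _ = _ := by ring

lemma wgt_two (s : ℝ) (p : R2) : wgt p ^ (2 * s) = (wgt p ^ s) ^ 2 := by
  rw [← Real.rpow_natCast, ← Real.rpow_mul (by linarith [wgt_one_le p]), mul_comm]; norm_num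

lemma X_eq {s b σ : ℝ} (hs : 0 ≤ s) (hb0 : 0 ≤ b) (hb1 : b ≤ 1) (hσ0 : 0 ≤ σ) (hσ1 : σ ≤ 1) (β : ℝ) (v V : 𝓢(R2, ℂ))
    (hV : ∀ p : R2, V p = FT2 v p.1 p.2) :
    ∫⁻ p, (Wx s b σ β p * ‖V p‖ₑ) ^ 2 = ENNReal.ofReal (XNorm s b β σ v ^ 2) := by
  have hfin := X_fin hs hb0 hb1 hσ0 hσ1 β V
  have e : ∀ p : R2, (Wx s b σ β p * ‖V p‖ₑ) ^ 2 = ENNReal.ofReal ((1 + |p.2| + |p.1| ^ ((1:ℝ)/3)) ^ (2 * s) * (nuWt b σ β p.1 p.2)^2 * ‖FT2 v p.1 p.2‖^2) := by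
    intro p
    have w := wgt_one_le p
    have n := (nuWt_pos b σ β p).le
    have : (1 + |p.2| + |p.1| ^ ((1:ℝ)/3)) ^ (2 * s) = (wgt p ^ s) ^ 2 := wgt_two s p
    rw [this, ← hV]
    unfold Wx
    rw [← ofReal_norm, ← ENNReal.ofReal_mul (by positivity), ← ENNReal.ofReal_pow (by positivity)]
    congr 1; ring
  have nn : ∀ p : R2, 0 ≤ (1 + |p.2| + |p.1| ^ ((1:ℝ)/3)) ^ (2 * s) * (nuWt b σ β p.1 p.2)^2 * ‖FT2 v p.1 p.2‖^2 := by
    intro p; positivity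
  unfold XNorm
  rw [Real.sq_sqrt (integral_nonneg nn), ofReal_integral_eq_lintegral_ofReal _ (Filter.Eventually.of_forall nn)]
  · exact lintegral_congr e
  · have m : Measurable fun p : R2 => (1 + |p.2| + |p.1| ^ ((1:ℝ)/3)) ^ (2 * s) * (nuWt b σ β p.1 p.2)^2 * ‖FT2 v p.1 p.2‖^2 := by
      simp_rw [← hV]
      have := meas_nu b σ β
      have := V.continuous.measurable
      fun_prop
    refine ⟨m.aestronglyMeasurable, ?_⟩
    rw [hasFiniteIntegral_iff_ofReal (Filter.Eventually.of_forall nn), ← lintegral_congr e]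
    exact hfin

lemma Y_le {s b σ : ℝ} (β : ℝ) (F : R2 → ℂ) :
    ENNReal.ofReal (YNorm s b β σ F ^ 2) ≤
      ∫⁻ p : R2, (ENNReal.ofReal (wgt p ^ s * gaWt b σ β p.1 p.2) * ‖FT2 F p.1 p.2‖ₑ) ^ 2 := by
  have nn : ∀ p : R2, 0 ≤ (1 + |p.2| + |p.1| ^ ((1:ℝ)/3)) ^ (2 * s) * (gaWt b σ β p.1 p.2)^2 * ‖FT2 F p.1 p.2‖^2 := by
    intro p; positivity
  unfold YNorm
  rw [Real.sq_sqrt (integral_nonneg nn)]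
  by_cases hi : Integrable fun p : R2 => (1 + |p.2| + |p.1| ^ ((1:ℝ)/3)) ^ (2 * s) * (gaWt b σ β p.1 p.2)^2 * ‖FT2 F p.1 p.2‖^2
  · rw [ofReal_integral_eq_lintegral_ofReal hi (Filter.Eventually.of_forall nn)]
    refine lintegral_mono fun p => le_of_eq ?_
    have w := wgt_one_le p
    have n := gaWt_nonneg b σ β p
    have : (1 + |p.2| + |p.1| ^ ((1:ℝ)/3)) ^ (2 * s) = (wgt p ^ s) ^ 2 := wgt_two s p
    simp only [this]
    rw [← ofReal_norm, ← ENNReal.ofReal_mul (by positivity), ← ENNReal.ofReal_pow (by positivity)]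
    congr 1; ring
  · rw [integral_undef hi]; simp

end

section

open MeasureTheory
open scoped SchwartzMap FourierTransform LineDeriv

lemma schw_lineD (v : 𝓢(R2, ℂ)) (q : R2) : HasLineDerivAt ℝ v ((∂_{((0, 1) : R2)} v) q) q (0, 1) := by
  rw [SchwartzMap.lineDerivOp_apply_eq_fderiv]
  exact v.differentiableAt.hasFDerivAt.hasLineDerivAt (0, 1)

lemma FT2_byparts {ψ : ℝ → ℝ} (hc : Continuous ψ) {B : ℝ} (hB : ∀ t, |ψ t| ≤ B) (v₁ v₂ : 𝓢(R2, ℂ)) (τ ξ : ℝ) :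
    FT2 (fun q => (ψ q.1 : ℂ) * deriv (fun x => v₁ (q.1, x) * v₂ (q.1, x)) q.2) τ ξ =
      (Complex.I * ξ) * FT2 (fun q => v₂ q * ((ψ q.1 : ℂ) * v₁ q)) τ ξ := by
  set d1 := ∂_{((0, 1) : R2)} v₁ with hd1
  set d2 := ∂_{((0, 1) : R2)} v₂ with hd2
  have hline : ∀ q : R2, HasDerivAt (fun t : ℝ => v₁ (q + t • ((0, 1) : R2)) * v₂ (q + t • ((0, 1) : R2)))
      (d1 q * v₂ q + v₁ q * d2 q) 0 := by
    intro q
    have h1 : HasDerivAt (fun t : ℝ => v₁ (q + t • ((0, 1) : R2))) (d1 q) 0 := schw_lineD v₁ q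
    have h2 : HasDerivAt (fun t : ℝ => v₂ (q + t • ((0, 1) : R2))) (d2 q) 0 := schw_lineD v₂ q
    have h3 := h1.fun_mul h2
    simp only [zero_smul, add_zero] at h3
    exact h3
  have hder : ∀ q : R2, deriv (fun x => v₁ (q.1, x) * v₂ (q.1, x)) q.2 = d1 q * v₂ q + v₁ q * d2 q := by
    intro q
    have h := hline q
    have h2 : HasDerivAt (fun t : ℝ => v₁ (q.1, q.2 + t) * v₂ (q.1, q.2 + t)) (d1 q * v₂ q + v₁ q * d2 q) (q.2 - q.2) := by
      rw [sub_self]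
      refine h.congr_of_eventuallyEq (Filter.Eventually.of_forall fun t => ?_)
      have : q + t • ((0, 1) : R2) = (q.1, q.2 + t) := by ext <;> simp
      simp only [this]
    have h3 := h2.comp_sub_const q.2 q.2
    simp only [add_sub_cancel] at h3
    exact h3.deriv
  obtain ⟨B1, -, hB1⟩ := schw_bdd v₁
  obtain ⟨B2, -, hB2⟩ := schw_bdd v₂
  have i0 : Integrable fun q : R2 => v₁ q * v₂ q :=
    v₂.integrable.bdd_mul (c := B1) v₁.continuous.aestronglyMeasurable (Filter.Eventually.of_forall hB1)
  have i1 : Integrable fun q : R2 => v₂ q * d1 q :=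
    d1.integrable.bdd_mul (c := B2) v₂.continuous.aestronglyMeasurable (Filter.Eventually.of_forall hB2)
  have i2 : Integrable fun q : R2 => v₁ q * d2 q :=
    d2.integrable.bdd_mul (c := B1) v₁.continuous.aestronglyMeasurable (Filter.Eventually.of_forall hB1)
  have i3 : Integrable fun q : R2 => d1 q * v₂ q + v₁ q * d2 q := by
    have := i1.add i2
    refine this.congr (Filter.Eventually.of_forall fun q => ?_)
    simp [mul_comm]
  have hψm : ∀ {h : R2 → ℂ}, Integrable h → Integrable fun q : R2 => (ψ q.1 : ℂ) * h q := by
    intro h hh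
    refine hh.bdd_mul (c := B) ?_ (Filter.Eventually.of_forall fun q => ?_)
    · exact (Complex.continuous_ofReal.comp (hc.comp continuous_fst)).aestronglyMeasurable
    · simpa using hB q.1
  have hem : ∀ {h : R2 → ℂ}, Integrable h → Integrable fun q : R2 => Complex.exp (-(Complex.I * (q.1 * τ + q.2 * ξ))) * h q := by
    intro h hh
    refine hh.bdd_mul (c := 1) ?_ (Filter.Eventually.of_forall fun q => ?_)
    · exact Continuous.aestronglyMeasurable (by fun_prop)
    · rw [Complex.norm_exp]
      apply le_of_eq
      rw [Real.exp_eq_one_iff]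
      simp
  have hparts := integral_bilinear_hasLineDerivAt_right_eq_neg_left_of_integrable (μ := (volume : Measure R2))
    (f := fun q : R2 => Complex.exp (-(Complex.I * (q.1 * τ + q.2 * ξ))))
    (f' := fun q : R2 => (-(Complex.I * ξ)) * Complex.exp (-(Complex.I * (q.1 * τ + q.2 * ξ))))
    (g := fun q : R2 => (ψ q.1 : ℂ) * (v₁ q * v₂ q))
    (g' := fun q : R2 => (ψ q.1 : ℂ) * (d1 q * v₂ q + v₁ q * d2 q)) (v := (0, 1)) (B := ContinuousLinearMap.mul ℝ ℂ)
    ?_ ?_ ?_ ?_ ?_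
  · simp only [ContinuousLinearMap.mul_apply'] at hparts
    unfold FT2
    simp_rw [hder]
    rw [hparts, ← integral_neg, ← integral_const_mul]
    refine integral_congr_ae (Filter.Eventually.of_forall fun q => ?_)
    simp only
    ring
  · simp only [ContinuousLinearMap.mul_apply', mul_assoc]
    exact (hem (hψm i0)).const_mul _
  · simp only [ContinuousLinearMap.mul_apply']
    exact hem (hψm i3)
  · simp only [ContinuousLinearMap.mul_apply']
    exact hem (hψm i0)
  · intro q _
    unfold HasLineDerivAt
    have h1 : HasDerivAt (fun t : ℝ => -(Complex.I * (q.1 * τ + ((q.2 : ℂ) + (t:ℂ)) * ξ))) (-(Complex.I * (1 * ξ))) 0 := by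
      have h0 : HasDerivAt (fun t : ℝ => (t : ℂ)) 1 0 := Complex.ofRealCLM.hasDerivAt
      exact ((((h0.const_add _).mul_const _).const_add _).const_mul _).neg
    have h2 := h1.cexp
    have h3 := (h2.congr_of_eventuallyEq (f₁ := fun t : ℝ => Complex.exp (-(Complex.I * (((q + t • ((0, 1) : R2)).1 : ℝ) * τ + ((q + t • ((0, 1) : R2)).2 : ℝ) * ξ))))
      (Filter.Eventually.of_forall fun t => by simp)).congr_deriv
      (g' := (-(Complex.I * ξ)) * Complex.exp (-(Complex.I * (q.1 * τ + q.2 * ξ)))) (by rw [Complex.ofReal_zero, add_zero]; ring)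
    exact h3
  · intro q _
    unfold HasLineDerivAt
    have := (hline q).const_mul (ψ q.1 : ℂ)
    simpa using this

theorem bilin_main (s b σ β : ℝ) (hs : 0 ≤ s)
    (hb : b ∈ Set.Ico (7/16 : ℝ) (1/2)) (hσ : σ ∈ Set.Ioo (1/2 : ℝ) (2/3))
    (ψ : ℝ → ℝ) (hψsmooth : ContDiff ℝ (⊤ : ℕ∞) ψ)
    (hψsupp : Function.support ψ ⊆ Set.Icc (-2) 2) :
    ∃ C > 0, ∀ v₁ v₂ : SchwartzMap (ℝ × ℝ) ℂ,
      YNorm s b β σ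
          (fun q => (ψ q.1 : ℂ) * deriv (fun x => v₁ (q.1, x) * v₂ (q.1, x)) q.2)
        ≤ C * XNorm s b β σ (⇑v₁) * XNorm s b β σ (⇑v₂) := by
  obtain ⟨hb1, hb2⟩ := hb
  obtain ⟨hσ1, hσ2⟩ := hσ
  have b0 : 0 ≤ b := by linarith
  have b1 : b ≤ 1 := by linarith
  have s0 : 0 ≤ σ := by linarith
  have s1 : σ ≤ 1 := by linarith
  obtain ⟨D, hD, hcore⟩ := core hs hb1 hσ1 hσ2.le β
  obtain ⟨Ψ, hΨ⟩ := psi_inv hψsmooth hψsupp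
  have mΨ : Measurable fun η => ‖Ψ η‖ₑ := Ψ.continuous.measurable.enorm
  set m := ∫⁻ η, ‖Ψ η‖ₑ * ENNReal.ofReal (mfac s (2 * Real.pi * η)) with hm
  have hmt : m ≠ ⊤ := by
    refine (lt_of_le_of_lt (lintegral_mono fun η => ?_) (schw_fin (volume : Measure ℝ) Ψ (2 ^ ⌈s⌉₊ * 8 ^ (⌈s⌉₊ + 1)) (⌈s⌉₊ + 1))).ne
    rw [mul_comm]
    exact mul_le_mul' (ENNReal.ofReal_le_ofReal (mfac_le hs η)) le_rfl
  have hBψ : ∃ B, ∀ t, |ψ t| ≤ B := by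
    refine ⟨∫ η, ‖Ψ η‖, fun t => ?_⟩
    have : |ψ t| = ‖(ψ t : ℂ)‖ := by simp
    rw [this, hΨ t]
    refine (norm_integral_le_integral_norm _).trans (le_of_eq ?_)
    refine integral_congr_ae (Filter.Eventually.of_forall fun η => ?_)
    simp only [norm_mul]
    rw [Complex.norm_exp]
    have : (Complex.I * (t * ((2 * Real.pi * η : ℝ) : ℂ))).re = 0 := by simp
    rw [this, Real.exp_zero, one_mul]
  obtain ⟨B, hB⟩ := hBψ
  have hψc := hψsmooth.continuous
  obtain ⟨c, hc⟩ := four2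
  set T : ENNReal := ‖(c : ℂ)‖ₑ ^ 2 * D * m ^ 2 with hT
  have hTt : T ≠ ⊤ := ENNReal.mul_ne_top (ENNReal.mul_ne_top (ENNReal.pow_ne_top enorm_ne_top) hD) (ENNReal.pow_ne_top hmt)
  refine ⟨√T.toReal + 1, by positivity, fun v₁ v₂ => ?_⟩
  obtain ⟨V1, hV1, -⟩ := hc v₁
  obtain ⟨V2, hV2, hv2⟩ := hc v₂
  have mV1 : Measurable fun p => ‖V1 p‖ₑ := V1.continuous.measurable.enorm
  have mV2 : Measurable fun p => ‖V2 p‖ₑ := V2.continuous.measurable.enorm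
  have iG : Integrable fun q : R2 => (ψ q.1 : ℂ) * v₁ q := by
    refine v₁.integrable.bdd_mul (c := B) ?_ (Filter.Eventually.of_forall fun q => ?_)
    · exact (Complex.continuous_ofReal.comp (hψc.comp continuous_fst)).aestronglyMeasurable
    · simpa using hB q.1
  let g1 : R2 → ENNReal := fun p => ∫⁻ η, ‖Ψ η‖ₑ * ‖V1 (p - (2 * Real.pi * η, 0))‖ₑ
  have mg1 : Measurable g1 := by
    have : Measurable fun z : R2 × ℝ => ‖Ψ z.2‖ₑ * ‖V1 (z.1 - (2 * Real.pi * z.2, 0))‖ₑ :=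
      (mΨ.comp measurable_snd).mul (mV1.comp (by fun_prop : Measurable fun z : R2 × ℝ => z.1 - (2 * Real.pi * z.2, 0)))
    exact this.lintegral_prod_right'
  have hG : ∀ p : R2, ‖FT2 (fun q => (ψ q.1 : ℂ) * v₁ q) p.1 p.2‖ₑ ≤ g1 p := by
    intro p
    rw [FT2_conv (volume : Measure ℝ) (φ := fun η => (2 * Real.pi * η, 0)) (by fun_prop) (M := Ψ) Ψ.integrable
      (G := v₁) v₁.integrable (u := fun q => (ψ q.1 : ℂ)) (fun q => by rw [hΨ]; simp) p]
    refine (enorm_integral_le_lintegral_enorm _).trans (le_of_eq ?_)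
    refine lintegral_congr fun η => ?_
    rw [enorm_mul, ← hV1]
  have hF : ∀ p : R2, ‖FT2 (fun q => (ψ q.1 : ℂ) * deriv (fun x => v₁ (q.1, x) * v₂ (q.1, x)) q.2) p.1 p.2‖ₑ ≤
      ENNReal.ofReal |p.2| * (‖(c : ℂ)‖ₑ * ∫⁻ a, ‖V2 a‖ₑ * g1 (p - a)) := by
    intro p
    rw [FT2_byparts hψc hB, FT2_conv (volume : Measure R2) (φ := fun a => a) measurable_id (M := fun a => c * V2 a)
      (V2.integrable.const_mul _) iG hv2 p, enorm_mul]
    refine mul_le_mul' (le_of_eq ?_) ?_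
    · rw [← ofReal_norm]; simp
    · refine (enorm_integral_le_lintegral_enorm _).trans ?_
      rw [← lintegral_const_mul]
      · refine lintegral_mono fun a => ?_
        rw [enorm_mul, enorm_mul, mul_assoc]
        exact mul_le_mul' le_rfl (mul_le_mul' le_rfl (hG _))
      · exact mV2.mul (mg1.comp (measurable_const.sub measurable_id))
  have hfin : ENNReal.ofReal (YNorm s b β σ
      (fun q => (ψ q.1 : ℂ) * deriv (fun x => v₁ (q.1, x) * v₂ (q.1, x)) q.2) ^ 2) ≤
      T * ENNReal.ofReal (XNorm s b β σ v₁ ^ 2) * ENNReal.ofReal (XNorm s b β σ v₂ ^ 2) := by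
    have mI : Measurable fun p : R2 => ∫⁻ a, ‖V2 a‖ₑ * g1 (p - a) := by
      have : Measurable fun z : R2 × R2 => ‖V2 z.2‖ₑ * g1 (z.1 - z.2) :=
        (mV2.comp measurable_snd).mul (mg1.comp (measurable_fst.sub measurable_snd))
      exact this.lintegral_prod_right'
    have mA : Measurable (Ay s b σ β) := by
      unfold Ay
      have := meas_ga b σ β
      have := meas_wgt
      fun_prop
    calc _ ≤ _ := Y_le β _
      _ ≤ ∫⁻ p : R2, ‖(c : ℂ)‖ₑ ^ 2 * (Ay s b σ β p * ∫⁻ a, ‖V2 a‖ₑ * g1 (p - a)) ^ 2 := by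
          refine lintegral_mono fun p => ?_
          rw [← mul_pow]
          refine pow_le_pow_left' ((mul_le_mul' le_rfl (hF p)).trans (le_of_eq ?_)) 2
          have w := wgt_one_le p
          have n := gaWt_nonneg b σ β p
          unfold Ay
          rw [ENNReal.ofReal_mul (p := wgt p ^ s * gaWt b σ β p.1 p.2) (by positivity)]
          ring
      _ = ‖(c : ℂ)‖ₑ ^ 2 * ∫⁻ p : R2, (Ay s b σ β p * ∫⁻ a, ‖V2 a‖ₑ * g1 (p - a)) ^ 2 :=
          lintegral_const_mul _ ((mA.mul mI).pow_const 2)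
      _ ≤ ‖(c : ℂ)‖ₑ ^ 2 * (D * (∫⁻ p, (Wx s b σ β p * ‖V2 p‖ₑ) ^ 2) * ∫⁻ p, (Wx s b σ β p * g1 p) ^ 2) :=
          mul_le_mul' le_rfl (hcore _ _ mV2 mg1)
      _ ≤ ‖(c : ℂ)‖ₑ ^ 2 * (D * (∫⁻ p, (Wx s b σ β p * ‖V2 p‖ₑ) ^ 2) * (m ^ 2 * ∫⁻ p, (Wx s b σ β p * ‖V1 p‖ₑ) ^ 2)) :=
          mul_le_mul' le_rfl (mul_le_mul' le_rfl (psi_bound hs b0 b1 s0 s1 β mΨ mV1))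
      _ = _ := by
          rw [X_eq hs b0 b1 s0 s1 β v₁ V1 hV1, X_eq hs b0 b1 s0 s1 β v₂ V2 hV2, hT]
          ring
  have x1 : 0 ≤ XNorm s b β σ v₁ := Real.sqrt_nonneg _
  have x2 : 0 ≤ XNorm s b β σ v₂ := Real.sqrt_nonneg _
  rw [← ENNReal.ofReal_toReal hTt, ← ENNReal.ofReal_mul ENNReal.toReal_nonneg, ← ENNReal.ofReal_mul (by positivity),
    ENNReal.ofReal_le_ofReal_iff (by positivity)] at hfin
  have h2 : T.toReal ≤ (√T.toReal + 1) ^ 2 := by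
    nlinarith [Real.sq_sqrt (ENNReal.toReal_nonneg (a := T)), Real.sqrt_nonneg T.toReal]
  refine le_of_sq_le_sq ?_ (by positivity)
  refine hfin.trans ?_
  calc _ ≤ (√T.toReal + 1) ^ 2 * XNorm s b β σ v₁ ^ 2 * XNorm s b β σ v₂ ^ 2 := by gcongr
    _ = _ := by ring

end

/-- Bilinear estimate for the KdV nonlinearity (Lemma 2.5, after Faminskii). -/
theorem bilinear_estimate (s b σ β : ℝ) (hs : 0 ≤ s)
    (hb : b ∈ Set.Ico (7/16 : ℝ) (1/2)) (hσ : σ ∈ Set.Ioo (1/2 : ℝ) (2/3))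
    (ψ : ℝ → ℝ) (hψsmooth : ContDiff ℝ (⊤ : ℕ∞) ψ)
    (hψsupp : Function.support ψ ⊆ Set.Icc (-2) 2)
    (hψone : ∀ t ∈ Set.Icc (-1:ℝ) 1, ψ t = 1) :
    ∃ C > 0, ∀ v₁ v₂ : SchwartzMap (ℝ × ℝ) ℂ,
      YNorm s b β σ
          (fun q => (ψ q.1 : ℂ) * deriv (fun x => v₁ (q.1, x) * v₂ (q.1, x)) q.2)
        ≤ C * XNorm s b β σ (⇑v₁) * XNorm s b β σ (⇑v₂) := by
  exact bilin_main s b σ β hs hb hσ ψ hψsmooth hψsupp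
end

section
/- Let r₁, r₂ : ℝ → ℂ be continuous with Re r₁(τ) ≥ 0, Re r₂(τ) ≥ 0, |r₁(τ)| ≤ C(1+|τ|)^{1/3}, |r₂(τ)| ≤ C(1+|τ|)^{1/3} and |r₁(τ) - r₂(τ)| ≥ δ for all τ ∈ ℝ (for some constants C, δ > 0), and let f, g : ℝ → ℂ be Schwartz functions. Define, for t ∈ ℝ and x ≤ 0, L¹f(t,x) = (1/2π)∫_ℝ e^{itτ} · (r₁(τ)e^{r₂(τ)x} - r₂(τ)e^{r₁(τ)x})/(r₁(τ)-r₂(τ)) · f̂(τ) dτ and L²g(t,x) = (1/2π)∫_ℝ e^{itτ} · (e^{r₁(τ)x} - e^{r₂(τ)x})/(r₁(τ)-r₂(τ)) · ĝ(τ) dτ (both integrals converge absolutely). Then for every t ∈ ℝ the maps x ↦ L¹f(t,x) and x ↦ L²g(t,x) are twice differentiable on (-∞,0] (one-sided derivatives at x = 0) and: L¹f(t,0) = f(t), ∂_x L¹f(t,0) = 0, ∂_x² L¹f(t,0) = -(1/2π)∫_ℝ e^{itτ} r₁(τ)r₂(τ) f̂(τ) dτ; L²g(t,0) = 0, ∂_x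 L²g(t,0) = g(t), ∂_x² L²g(t,0) = (1/2π)∫_ℝ e^{itτ} (r₁(τ)+r₂(τ)) ĝ(τ) dτ. -/
open MeasureTheory

/-- One-dimensional Fourier transform: `f̂(τ) = ∫ e^{-iτt} f(t) dt`. -/
noncomputable def FT1 (f : ℝ → ℂ) (τ : ℝ) : ℂ :=
  ∫ t : ℝ, Complex.exp (-(Complex.I * τ * t)) * f t

/-- The left half-line boundary potential
`L¹f(t,x) = (1/2π)∫ e^{itτ}(r₁e^{r₂x} - r₂e^{r₁x})/(r₁-r₂) f̂(τ) dτ`. -/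
noncomputable def L1pot (r₁ r₂ : ℝ → ℂ) (f : ℝ → ℂ) (t x : ℝ) : ℂ :=
  (1 / (2 * (Real.pi : ℂ))) *
    ∫ τ : ℝ, Complex.exp (Complex.I * t * τ) *
      ((r₁ τ * Complex.exp (r₂ τ * x) - r₂ τ * Complex.exp (r₁ τ * x)) /
        (r₁ τ - r₂ τ)) * FT1 f τ

/-- The left half-line boundary potential
`L²g(t,x) = (1/2π)∫ e^{itτ}(e^{r₁x} - e^{r₂x})/(r₁-r₂) ĝ(τ) dτ`. -/
noncomputable def L2pot (r₁ r₂ : ℝ → ℂ) (g : ℝ → ℂ) (t x : ℝ) : ℂ :=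
  (1 / (2 * (Real.pi : ℂ))) *
    ∫ τ : ℝ, Complex.exp (Complex.I * t * τ) *
      ((Complex.exp (r₁ τ * x) - Complex.exp (r₂ τ * x)) / (r₁ τ - r₂ τ)) * FT1 g τ


open FourierTransform

/-- Continuous functions of polynomial growth. -/
def PG (a : ℝ → ℂ) : Prop :=
  Continuous a ∧ ∃ K : ℝ, ∃ k : ℕ, 0 ≤ K ∧ ∀ τ, ‖a τ‖ ≤ K * (1 + |τ|) ^ k

/-- Continuous functions of rapid decay. -/
def RD (F : ℝ → ℂ) : Prop :=
  Continuous F ∧ ∀ k : ℕ, Integrable (fun τ : ℝ => (1 + |τ|) ^ k * ‖F τ‖)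

lemma PG.mul {a b : ℝ → ℂ} (ha : PG a) (hb : PG b) : PG (fun τ => a τ * b τ) := by
  obtain ⟨ca, K, k, hK, h⟩ := ha
  obtain ⟨cb, L, l, hL, h'⟩ := hb
  refine ⟨ca.mul cb, K * L, k + l, by positivity, fun τ => ?_⟩
  rw [norm_mul]
  calc ‖a τ‖ * ‖b τ‖ ≤ (K * (1 + |τ|) ^ k) * (L * (1 + |τ|) ^ l) :=
        mul_le_mul (h τ) (h' τ) (norm_nonneg _) (by positivity)
    _ = _ := by ring

lemma PG.of_bounded {a : ℝ → ℂ} (hc : Continuous a) (K : ℝ) (h : ∀ τ, ‖a τ‖ ≤ K) : PG a :=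
  ⟨hc, K, 0, (norm_nonneg _).trans (h 0), by simpa using h⟩

lemma PG.integrable {a F : ℝ → ℂ} (ha : PG a) (hF : RD F) :
    Integrable (fun τ => a τ * F τ) := by
  obtain ⟨ca, K, k, hK, h⟩ := ha
  refine ((hF.2 k).const_mul K).mono' (ca.mul hF.1).aestronglyMeasurable ?_
  refine Filter.Eventually.of_forall fun τ => ?_
  rw [norm_mul, ← mul_assoc]
  exact mul_le_mul_of_nonneg_right (h τ) (norm_nonneg _)

lemma norm_exp_le {r : ℂ} (hr : 0 ≤ r.re) {x : ℝ} (hx : x ≤ 0) : ‖Complex.exp (r * x)‖ ≤ 1 := by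
  rw [Complex.norm_exp]
  simp only [Complex.mul_re, Complex.ofReal_re, Complex.ofReal_im, mul_zero, sub_zero]
  exact Real.exp_le_one_iff.2 (mul_nonpos_of_nonneg_of_nonpos hr hx)

lemma PG.exp {r : ℝ → ℂ} (hr : PG r) (hre : ∀ τ, 0 ≤ (r τ).re) {x : ℝ} (hx : x ≤ 0) :
    PG (fun τ => Complex.exp (r τ * x)) :=
  PG.of_bounded (by have := hr.1; fun_prop) 1 fun τ => norm_exp_le (hre τ) hx

lemma hasDeriv_exp (r : ℂ) (x : ℝ) :
    HasDerivAt (fun y : ℝ => Complex.exp (r * y)) (r * Complex.exp (r * x)) x := by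
  have h := ((Complex.ofRealCLM.hasDerivAt (x := x)).const_mul r).cexp
  simpa [mul_comm] using h

lemma exp_lip {r : ℂ} (hr : 0 ≤ r.re) {x y : ℝ} (hx : x ≤ 0) (hy : y ≤ 0) :
    ‖Complex.exp (r * y) - Complex.exp (r * x)‖ ≤ ‖r‖ * |y - x| := by
  refine (convex_Iic (0:ℝ)).norm_image_sub_le_of_norm_hasDerivWithin_le
    (f := fun y : ℝ => Complex.exp (r * y)) (f' := fun x : ℝ => r * Complex.exp (r * x))
    (fun z _ => (hasDeriv_exp r z).hasDerivWithinAt) (fun z hz => ?_) hx hy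
  rw [norm_mul]
  exact mul_le_of_le_one_right (norm_nonneg _) (norm_exp_le hr hz)

lemma deriv_int {a r F : ℝ → ℂ} (ha : PG a) (hr : PG r) (hre : ∀ τ, 0 ≤ (r τ).re) (hF : RD F)
    {x : ℝ} (hx : x ≤ 0) :
    HasDerivWithinAt (fun y : ℝ => ∫ τ, a τ * Complex.exp (r τ * y) * F τ)
      (∫ τ, a τ * r τ * Complex.exp (r τ * x) * F τ) (Set.Iic 0) x := by
  rw [hasDerivWithinAt_iff_tendsto_slope]
  have hI : ∀ y : ℝ, y ≤ 0 → Integrable (fun τ => a τ * Complex.exp (r τ * y) * F τ) :=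
    fun y hy => (ha.mul (hr.exp hre hy)).integrable hF
  have key : Filter.Tendsto (fun y : ℝ => ∫ τ, a τ * F τ *
        slope (fun y : ℝ => Complex.exp (r τ * y)) x y) (nhdsWithin x (Set.Iic 0 \ {x}))
      (nhds (∫ τ, a τ * F τ * (r τ * Complex.exp (r τ * x)))) := by
    refine tendsto_integral_filter_of_dominated_convergence (fun τ => ‖a τ * r τ * F τ‖) ?_ ?_
      ((ha.mul hr).integrable hF).norm ?_
    · refine Filter.Eventually.of_forall fun y => Continuous.aestronglyMeasurable ?_
      have h1 := ha.1
      have h2 := hr.1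
      have h3 := hF.1
      simp only [slope, vsub_eq_sub]
      fun_prop
    · filter_upwards [self_mem_nhdsWithin] with y hy
      refine Filter.Eventually.of_forall fun τ => ?_
      have hyx : 0 < |y - x| := abs_pos.2 (sub_ne_zero.2 hy.2)
      have : ‖slope (fun y : ℝ => Complex.exp (r τ * y)) x y‖ ≤ ‖r τ‖ := by
        simp only [slope, vsub_eq_sub, norm_smul, norm_inv, Real.norm_eq_abs]
        rw [inv_mul_le_iff₀ hyx, mul_comm |y - x|]
        exact exp_lip (hre τ) hx hy.1
      calc _ = ‖a τ‖ * ‖F τ‖ * ‖slope (fun y : ℝ => Complex.exp (r τ * y)) x y‖ := by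
              rw [norm_mul, norm_mul]
        _ ≤ ‖a τ‖ * ‖F τ‖ * ‖r τ‖ := by gcongr
        _ = _ := by rw [norm_mul, norm_mul]; ring
    · refine Filter.Eventually.of_forall fun τ => ?_
      exact (hasDerivWithinAt_iff_tendsto_slope.1
        (hasDeriv_exp (r τ) x).hasDerivWithinAt).const_mul _
  have e : (∫ τ, a τ * r τ * Complex.exp (r τ * x) * F τ) =
      ∫ τ, a τ * F τ * (r τ * Complex.exp (r τ * x)) := by
    congr 1; ext τ; ring
  rw [e]
  refine key.congr' ?_
  filter_upwards [self_mem_nhdsWithin] with y hy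
  rw [slope, vsub_eq_sub, ← integral_sub (hI y hy.1) (hI x hx), ← integral_smul]
  congr 1; ext τ
  simp only [slope, vsub_eq_sub, Complex.real_smul]
  ring

lemma FT1_eq (f : SchwartzMap ℝ ℂ) (τ : ℝ) :
    FT1 f τ = (𝓕 f : SchwartzMap ℝ ℂ) (τ / (2 * Real.pi)) := by
  rw [SchwartzMap.fourier_coe, Real.fourier_eq', FT1]
  congr 1; ext t
  rw [smul_eq_mul]
  congr 2
  have : (Real.pi : ℂ) ≠ 0 := by exact_mod_cast Real.pi_ne_zero
  simp
  field_simp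

lemma RD_FT1 (f : SchwartzMap ℝ ℂ) : RD (FT1 f) := by
  have e : FT1 f = fun τ => (𝓕 f : SchwartzMap ℝ ℂ) (τ / (2 * Real.pi)) := funext (FT1_eq f)
  have hc : Continuous (FT1 f) := by
    rw [e]; exact (𝓕 f : SchwartzMap ℝ ℂ).continuous.comp (by fun_prop)
  refine ⟨hc, fun k => ?_⟩
  have hp := Real.two_pi_pos
  have hpw : ∀ k : ℕ, Integrable (fun τ : ℝ => |τ| ^ k * ‖FT1 f τ‖) := fun k => by
    have h1 := (𝓕 f : SchwartzMap ℝ ℂ).integrable_pow_mul volume k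
    have h2 := (h1.comp_div hp.ne').const_mul ((2 * Real.pi) ^ k)
    refine h2.congr (Filter.Eventually.of_forall fun τ => ?_)
    simp only [FT1_eq, Real.norm_eq_abs, abs_div, abs_of_pos hp]
    rw [← mul_assoc, ← mul_pow, mul_div_cancel₀ _ hp.ne']
  refine (((hpw 0).add (hpw k)).const_mul (2 ^ k)).mono'
    (by fun_prop) (Filter.Eventually.of_forall fun τ => ?_)
  have h0 := abs_nonneg τ
  simp only [Pi.add_apply]
  rw [Real.norm_of_nonneg (by positivity), ← add_mul, ← mul_assoc]
  gcongr
  rw [pow_zero]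
  rcases le_total |τ| 1 with h | h
  · calc (1 + |τ|) ^ k ≤ 2 ^ k := by gcongr; linarith
      _ ≤ _ := le_mul_of_one_le_right (by positivity) (by linarith [pow_nonneg h0 k])
  · calc (1 + |τ|) ^ k ≤ (2 * |τ|) ^ k := by gcongr; linarith
      _ = 2 ^ k * |τ| ^ k := mul_pow _ _ _
      _ ≤ _ := by gcongr; linarith

lemma inversion (f : SchwartzMap ℝ ℂ) (t : ℝ) :
    (1 / (2 * (Real.pi : ℂ))) * ∫ τ : ℝ, Complex.exp (Complex.I * t * τ) * FT1 f τ = f t := by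
  have hp := Real.two_pi_pos
  have hpi : (Real.pi : ℂ) ≠ 0 := by exact_mod_cast Real.pi_ne_zero
  have h : (𝓕⁻ (𝓕 f : SchwartzMap ℝ ℂ) : SchwartzMap ℝ ℂ) t = f t := by simp
  rw [SchwartzMap.fourierInv_coe, Real.fourierInv_eq'] at h
  have h2 := Measure.integral_comp_div (fun v : ℝ =>
    Complex.exp (Complex.I * t * (2 * Real.pi * v)) * (𝓕 f : SchwartzMap ℝ ℂ) v) (2 * Real.pi)
  have e : (∫ τ : ℝ, Complex.exp (Complex.I * t * τ) * FT1 f τ) = ∫ τ : ℝ,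
      Complex.exp (Complex.I * t * (2 * Real.pi * ((τ / (2 * Real.pi) : ℝ) : ℂ))) *
        (𝓕 f : SchwartzMap ℝ ℂ) (τ / (2 * Real.pi)) := by
    congr 1; ext τ
    rw [FT1_eq]
    congr 2
    push_cast
    field_simp
  rw [e, h2, abs_of_pos hp, Complex.real_smul, ← h]
  push_cast
  rw [← mul_assoc, one_div, inv_mul_cancel₀ (by simp [hpi]), one_mul]
  congr 1; ext v
  rw [smul_eq_mul]
  congr 2
  simp
  ring



/-- Trace and boundary-derivative identities for the left half-line
potentials `L¹` and `L²`. -/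
theorem Lpot_traces (C δ : ℝ) (hC : 0 < C) (hδ : 0 < δ)
    (r₁ r₂ : ℝ → ℂ) (hcont₁ : Continuous r₁) (hcont₂ : Continuous r₂)
    (hre₁ : ∀ τ : ℝ, 0 ≤ (r₁ τ).re) (hre₂ : ∀ τ : ℝ, 0 ≤ (r₂ τ).re)
    (hbd₁ : ∀ τ : ℝ, ‖r₁ τ‖ ≤ C * (1 + |τ|) ^ ((1:ℝ)/3))
    (hbd₂ : ∀ τ : ℝ, ‖r₂ τ‖ ≤ C * (1 + |τ|) ^ ((1:ℝ)/3))
    (hsep : ∀ τ : ℝ, δ ≤ ‖r₁ τ - r₂ τ‖)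
    (f g : SchwartzMap ℝ ℂ) :
    ∀ t : ℝ,
      (∀ x : ℝ, x ≤ 0 → Integrable (fun τ : ℝ =>
        Complex.exp (Complex.I * t * τ) *
          ((r₁ τ * Complex.exp (r₂ τ * x) - r₂ τ * Complex.exp (r₁ τ * x)) /
            (r₁ τ - r₂ τ)) * FT1 (⇑f) τ)) ∧
      (∀ x : ℝ, x ≤ 0 → Integrable (fun τ : ℝ =>
        Complex.exp (Complex.I * t * τ) *
          ((Complex.exp (r₁ τ * x) - Complex.exp (r₂ τ * x)) / (r₁ τ - r₂ τ)) *
          FT1 (⇑g) τ)) ∧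
      L1pot r₁ r₂ (⇑f) t 0 = f t ∧
      L2pot r₁ r₂ (⇑g) t 0 = 0 ∧
      (∃ D1 : ℝ → ℂ,
        (∀ x ∈ Set.Iic (0:ℝ),
          HasDerivWithinAt (fun y => L1pot r₁ r₂ (⇑f) t y) (D1 x) (Set.Iic 0) x) ∧
        D1 0 = 0 ∧
        ∃ D2 : ℝ → ℂ,
          (∀ x ∈ Set.Iic (0:ℝ), HasDerivWithinAt D1 (D2 x) (Set.Iic 0) x) ∧
          D2 0 = -((1 / (2 * (Real.pi : ℂ))) *
            ∫ τ : ℝ, Complex.exp (Complex.I * t * τ) * (r₁ τ * r₂ τ) * FT1 (⇑f) τ)) ∧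
      (∃ E1 : ℝ → ℂ,
        (∀ x ∈ Set.Iic (0:ℝ),
          HasDerivWithinAt (fun y => L2pot r₁ r₂ (⇑g) t y) (E1 x) (Set.Iic 0) x) ∧
        E1 0 = g t ∧
        ∃ E2 : ℝ → ℂ,
          (∀ x ∈ Set.Iic (0:ℝ), HasDerivWithinAt E1 (E2 x) (Set.Iic 0) x) ∧
          E2 0 = (1 / (2 * (Real.pi : ℂ))) *
            ∫ τ : ℝ, Complex.exp (Complex.I * t * τ) * (r₁ τ + r₂ τ) * FT1 (⇑g) τ) := by
  intro t
  have hne : ∀ τ, r₁ τ - r₂ τ ≠ 0 := fun τ h => by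
    have := hsep τ
    rw [h, norm_zero] at this
    linarith
  have PGr : ∀ r : ℝ → ℂ, Continuous r → (∀ τ : ℝ, ‖r τ‖ ≤ C * (1 + |τ|) ^ ((1:ℝ)/3)) → PG r := by
    intro r hr hb
    refine ⟨hr, C, 1, hC.le, fun τ => (hb τ).trans ?_⟩
    have h0 := abs_nonneg τ
    have : (1 + |τ|) ^ ((1:ℝ)/3) ≤ (1 + |τ|) ^ (1:ℝ) :=
      Real.rpow_le_rpow_of_exponent_le (by linarith) (by norm_num)
    rw [Real.rpow_one] at this
    rw [pow_one]
    gcongr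
  have h1 := PGr r₁ hcont₁ hbd₁
  have h2 := PGr r₂ hcont₂ hbd₂
  have hd : PG (fun τ => (r₁ τ - r₂ τ)⁻¹) := by
    refine PG.of_bounded ((hcont₁.sub hcont₂).inv₀ hne) δ⁻¹ fun τ => ?_
    rw [norm_inv]
    exact inv_anti₀ hδ (hsep τ)
  have he : PG (fun τ : ℝ => Complex.exp (Complex.I * t * τ)) := by
    refine PG.of_bounded (by fun_prop) 1 fun τ => ?_
    rw [Complex.norm_exp]
    simp
  have ha := he.mul hd
  have ha1 := ha.mul h1
  have ha2 := ha.mul h2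
  have hF := RD_FT1 f
  have hG := RD_FT1 g
  have iL1 : ∀ x : ℝ, x ≤ 0 → _ := fun x hx => (ha1.mul (h2.exp hre₂ hx)).integrable hF
  have iL1' : ∀ x : ℝ, x ≤ 0 → _ := fun x hx => (ha2.mul (h1.exp hre₁ hx)).integrable hF
  have iL2 : ∀ x : ℝ, x ≤ 0 → _ := fun x hx => (ha.mul (h1.exp hre₁ hx)).integrable hG
  have iL2' : ∀ x : ℝ, x ≤ 0 → _ := fun x hx => (ha.mul (h2.exp hre₂ hx)).integrable hG
  have eL1 : ∀ x : ℝ, x ≤ 0 → L1pot r₁ r₂ f t x = (1 / (2 * (Real.pi : ℂ))) *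
      ((∫ τ : ℝ, Complex.exp (Complex.I * t * τ) * (r₁ τ - r₂ τ)⁻¹ * r₁ τ *
        Complex.exp (r₂ τ * x) * FT1 f τ) -
      ∫ τ : ℝ, Complex.exp (Complex.I * t * τ) * (r₁ τ - r₂ τ)⁻¹ * r₂ τ *
        Complex.exp (r₁ τ * x) * FT1 f τ) := by
    intro x hx
    rw [← integral_sub (iL1 x hx) (iL1' x hx), L1pot]
    congr 2; ext τ
    rw [div_eq_mul_inv]; ring
  have eL2 : ∀ x : ℝ, x ≤ 0 → L2pot r₁ r₂ g t x = (1 / (2 * (Real.pi : ℂ))) *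
      ((∫ τ : ℝ, Complex.exp (Complex.I * t * τ) * (r₁ τ - r₂ τ)⁻¹ *
        Complex.exp (r₁ τ * x) * FT1 g τ) -
      ∫ τ : ℝ, Complex.exp (Complex.I * t * τ) * (r₁ τ - r₂ τ)⁻¹ *
        Complex.exp (r₂ τ * x) * FT1 g τ) := by
    intro x hx
    rw [← integral_sub (iL2 x hx) (iL2' x hx), L2pot]
    congr 2; ext τ
    rw [div_eq_mul_inv]; ring
  have z0 : (0:ℝ) ≤ 0 := le_rfl
  refine ⟨?_, ?_, ?_, ?_, ⟨_, fun x hx => HasDerivWithinAt.congr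
      (((deriv_int ha1 h2 hre₂ hF hx).sub (deriv_int ha2 h1 hre₁ hF hx)).const_mul
        (1 / (2 * (Real.pi : ℂ)))) (fun y hy => eL1 y hy) (eL1 x hx), ?_, _, fun x hx =>
      ((deriv_int (ha1.mul h2) h2 hre₂ hF hx).sub (deriv_int (ha2.mul h1) h1 hre₁ hF hx)).const_mul
        (1 / (2 * (Real.pi : ℂ))), ?_⟩,
      ⟨_, fun x hx => HasDerivWithinAt.congr
      (((deriv_int ha h1 hre₁ hG hx).sub (deriv_int ha h2 hre₂ hG hx)).const_mul
        (1 / (2 * (Real.pi : ℂ)))) (fun y hy => eL2 y hy) (eL2 x hx), ?_, _, fun x hx =>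
      ((deriv_int ha1 h1 hre₁ hG hx).sub (deriv_int ha2 h2 hre₂ hG hx)).const_mul
        (1 / (2 * (Real.pi : ℂ))), ?_⟩⟩
  · intro x hx
    refine ((iL1 x hx).sub (iL1' x hx)).congr (Filter.Eventually.of_forall fun τ => ?_)
    simp only [Pi.sub_apply]
    rw [div_eq_mul_inv]; ring
  · intro x hx
    refine ((iL2 x hx).sub (iL2' x hx)).congr (Filter.Eventually.of_forall fun τ => ?_)
    simp only [Pi.sub_apply]
    rw [div_eq_mul_inv]; ring
  · rw [← inversion f t, L1pot]
    congr 2; ext τ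
    simp [div_self (hne τ)]
  · simp [L2pot]
  · rw [mul_eq_zero]; right
    rw [sub_eq_zero]
    congr 1; ext τ
    simp only [Complex.ofReal_zero, mul_zero, Complex.exp_zero]
    ring
  · rw [← integral_sub (((ha1.mul h2).mul h2 |>.mul (h2.exp hre₂ z0)).integrable hF)
      (((ha2.mul h1).mul h1 |>.mul (h1.exp hre₁ z0)).integrable hF), ← mul_neg, ← integral_neg]
    congr 2; ext τ
    have := hne τ
    simp only [Complex.ofReal_zero, mul_zero, Complex.exp_zero]
    field_simp
    ring
  · rw [← inversion g t, ← integral_sub ((ha1.mul (h1.exp hre₁ z0)).integrable hG)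
      ((ha2.mul (h2.exp hre₂ z0)).integrable hG)]
    congr 2; ext τ
    have := hne τ
    simp only [Complex.ofReal_zero, mul_zero, Complex.exp_zero]
    field_simp
  · rw [← integral_sub (((ha1.mul h1).mul (h1.exp hre₁ z0)).integrable hG)
      (((ha2.mul h2).mul (h2.exp hre₂ z0)).integrable hG)]
    congr 2; ext τ
    have := hne τ
    simp only [Complex.ofReal_zero, mul_zero, Complex.exp_zero]
    field_simp
    ring
end

section
/- Let Y be a real Banach space, Ω₁ ⊆ Y open, and S : Ω₁ → Y a map that is twice continuously Fréchet differentiable in an open neighborhood of a point φ ∈ Ω₁ with S(φ) = φ. Suppose the spectral radius of the Fréchet derivative S'(φ), namely r(S'(φ)) = lim_{n→∞} ‖(S'(φ))ⁿ‖^{1/n}, satisfies r(S'(φ)) > 1 (in particular this holds if S'(φ) has a spectral value μ with |μ| > 1). Then φ is an unstable fixed point of S: there exists ε₀ > 0 such that the closed ball of radius ε₀ about φ is contained in Ω₁ and, for every η > 0, there exist y ∈ Ω₁ with ‖y - φ‖ < η and an integer N ≥ 1 such that the iterates S^k(y) are defined and satisfy ‖S^k(y) - φ‖ < ε₀ for all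 0 ≤ k < N, while ‖S^N(y) - φ‖ ≥ ε₀. -/
open Filter

lemma henry_variation {Y : Type*} [NormedAddCommGroup Y] [NormedSpace ℝ Y]
    (L : Y →L[ℝ] Y) (x : ℕ → Y) (k : ℕ) :
    x k = (L ^ k) (x 0) +
      ∑ j ∈ Finset.range k, (L ^ (k - 1 - j)) (x (j + 1) - L (x j)) := by
  induction k with
  | zero => simp
  | succ k ih =>
    have h1 : ∑ j ∈ Finset.range k, (L ^ (k + 1 - 1 - j)) (x (j + 1) - L (x j))
        = L (∑ j ∈ Finset.range k, (L ^ (k - 1 - j)) (x (j + 1) - L (x j))) := by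
      rw [map_sum]
      refine Finset.sum_congr rfl fun j hj => ?_
      have hj' := Finset.mem_range.1 hj
      have : k + 1 - 1 - j = (k - 1 - j) + 1 := by omega
      rw [this, pow_succ']
      rfl
    have h2 : (L ^ (k + 1)) (x 0) = L ((L ^ k) (x 0)) := by
      rw [pow_succ']; rfl
    rw [Finset.sum_range_succ, h1, h2, ← add_assoc, ← map_add, ← ih]
    simp

lemma henry_quadratic {Y : Type*} [NormedAddCommGroup Y] [NormedSpace ℝ Y]
    (S : Y → Y) (φ : Y) (h : ContDiffAt ℝ 2 S φ) :
    ∃ M > 0, ∃ δ > 0, ∀ z, ‖z - φ‖ ≤ δ →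
      ‖S z - S φ - fderiv ℝ S φ (z - φ)‖ ≤ M * ‖z - φ‖ ^ 2 := by
  have h1 : ContDiffAt ℝ 1 (fderiv ℝ S) φ := h.fderiv_right (by norm_num)
  obtain ⟨K, t, ht, hK⟩ := h1.exists_lipschitzOnWith
  have h2 : ∀ᶠ z in nhds φ, DifferentiableAt ℝ S z :=
    (h.eventually (by simp)).mono fun z hz => hz.differentiableAt (by simp)
  obtain ⟨δ, hδ, hb⟩ := Metric.nhds_basis_closedBall.mem_iff.1 (inter_mem ht h2)
  refine ⟨K + 1, by positivity, δ, hδ, fun z hz => ?_⟩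
  have key : ‖S z - S φ - fderiv ℝ S φ (z - φ)‖ ≤ (K * ‖z - φ‖) * ‖z - φ‖ := by
    refine Convex.norm_image_sub_le_of_norm_hasFDerivWithin_le' (𝕜 := ℝ)
      (s := Metric.closedBall φ ‖z - φ‖) (f' := fderiv ℝ S) ?_ ?_
      (convex_closedBall _ _) (by simp) (by simp [dist_eq_norm])
    · intro w hw
      have := hb (Metric.closedBall_subset_closedBall hz hw)
      exact this.2.hasFDerivAt.hasFDerivWithinAt
    · intro w hw
      have := hb (Metric.closedBall_subset_closedBall hz hw)
      have h3 := hK.dist_le_mul w this.1 φ (mem_of_mem_nhds ht)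
      rw [dist_eq_norm] at h3
      exact h3.trans (by gcongr; exact hw)
  nlinarith [sq_nonneg ‖z - φ‖]

/-- The core estimate along a finite orbit. -/
lemma henry_orbit {Y : Type*} [NormedAddCommGroup Y] [NormedSpace ℝ Y]
    (L : Y →L[ℝ] Y) (x : ℕ → Y) (K σ ρ M δ a : ℝ) (n : ℕ)
    (hK : 0 < K) (hσ : 0 < σ) (hρ : 1 < ρ) (hσρ : σ < ρ ^ 2) (hM : 0 < M) (ha : 0 < a)
    (hL : ∀ m, ‖L ^ m‖ ≤ K * σ ^ m)
    (hx : ∀ j, ‖x j‖ ≤ δ → ‖x (j + 1) - L (x j)‖ ≤ M * ‖x j‖ ^ 2)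
    (haδ : 2 * a ≤ δ) (haC : 4 * K * M * a ≤ (ρ ^ 2 - σ) / 4)
    (hlin : ∀ k ≤ n, ‖(L ^ k) (x 0)‖ ≤ a * (ρ ^ k / ρ ^ n)) :
    ‖x n - (L ^ n) (x 0)‖ ≤ a / 4 := by
  have hρ0 : 0 < ρ := by linarith
  set q : ℕ → ℝ := fun k => ρ ^ k / ρ ^ n with hq
  have hq0 : ∀ k, 0 ≤ q k := fun k => by simp only [hq]; positivity
  have hq1 : ∀ k ≤ n, q k ≤ 1 := fun k hk => by
    simp only [hq]
    rw [div_le_one (by positivity)]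
    exact pow_le_pow_right₀ hρ.le hk
  have step : ∀ k ≤ n, (∀ j < k, ‖x j‖ ≤ 2 * a * q j) →
      ‖x k - (L ^ k) (x 0)‖ ≤ a / 4 * q k := by
    intro k hk ih
    have e : x k - (L ^ k) (x 0) =
        ∑ j ∈ Finset.range k, (L ^ (k - 1 - j)) (x (j + 1) - L (x j)) := by
      rw [sub_eq_iff_eq_add']; exact henry_variation L x k
    rw [e]
    have b : ∀ j ∈ Finset.range k, ‖(L ^ (k - 1 - j)) (x (j + 1) - L (x j))‖ ≤
        (4 * K * M * a ^ 2 / (ρ ^ n) ^ 2) * ((ρ ^ 2) ^ j * σ ^ (k - 1 - j)) := by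
      intro j hj
      have hj' := Finset.mem_range.1 hj
      have i1 := ih j hj'
      have i2 : ‖x j‖ ≤ δ := by
        have := hq1 j (by omega)
        nlinarith
      have i3 : ‖x (j + 1) - L (x j)‖ ≤ M * (2 * a * q j) ^ 2 :=
        (hx j i2).trans (by gcongr)
      calc _ ≤ ‖L ^ (k - 1 - j)‖ * ‖x (j + 1) - L (x j)‖ := ContinuousLinearMap.le_opNorm _ _
        _ ≤ (K * σ ^ (k - 1 - j)) * (M * (2 * a * q j) ^ 2) := by
          gcongr
          exact hL _
        _ = _ := by
          simp only [hq]
          rw [← pow_mul ρ 2 j, mul_comm 2 j, pow_mul ρ j 2]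
          field_simp
          ring
    have g := (Commute.all (ρ ^ 2) σ).geom_sum₂_mul k
    have g' : ∑ j ∈ Finset.range k, (ρ ^ 2) ^ j * σ ^ (k - 1 - j) ≤
        (ρ ^ k) ^ 2 / (ρ ^ 2 - σ) := by
      rw [le_div_iff₀ (by linarith), g, ← pow_mul, mul_comm 2 k, pow_mul]
      have : 0 < σ ^ k := by positivity
      linarith
    refine (norm_sum_le_of_le _ b).trans ?_
    rw [← Finset.mul_sum]
    have hd : 0 < ρ ^ 2 - σ := by linarith
    calc _ ≤ (4 * K * M * a ^ 2 / (ρ ^ n) ^ 2) * ((ρ ^ k) ^ 2 / (ρ ^ 2 - σ)) := by gcongr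
      _ = (4 * K * M * a) / (ρ ^ 2 - σ) * a * (q k * q k) := by
        simp only [hq]
        field_simp
      _ ≤ (1 / 4) * a * (1 * q k) := by
        have : (4 * K * M * a) / (ρ ^ 2 - σ) ≤ 1 / 4 := by
          rw [div_le_iff₀ hd]; linarith
        have := hq1 k hk
        have := hq0 k
        gcongr
      _ = _ := by ring
  have all : ∀ k, k ≤ n → ‖x k‖ ≤ 2 * a * q k := by
    intro k
    induction k using Nat.strong_induction_on with
    | _ k ih =>
      intro hk
      have h1 := step k hk fun j hj => ih j hj (by omega)
      have h2 := hlin k hk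
      have h3 : ‖x k‖ ≤ ‖x k - (L ^ k) (x 0)‖ + ‖(L ^ k) (x 0)‖ := by
        simpa using norm_add_le (x k - (L ^ k) (x 0)) ((L ^ k) (x 0))
      have h4 : 0 ≤ a * q k := mul_nonneg ha.le (hq0 k)
      change _ ≤ a * q k at h2
      linarith
  have h := step n le_rfl fun j hj => all j hj.le
  have : q n ≤ 1 := hq1 n le_rfl
  nlinarith

/-- Instability of a fixed point of a `C²` map whose derivative has spectral
radius `r(S'(φ)) = lim ‖(S'(φ))ⁿ‖^{1/n} > 1` (Corollary of the
Henry–Perez–Wreszinski theorem). -/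
theorem henry_instability_C2 {Y : Type*} [NormedAddCommGroup Y]
    [NormedSpace ℝ Y] [CompleteSpace Y] (Ω₁ : Set Y) (hΩ₁ : IsOpen Ω₁)
    (S : Y → Y) (φ : Y) (hφ : φ ∈ Ω₁)
    (U : Set Y) (hU : IsOpen U) (hφU : φ ∈ U) (hUΩ : U ⊆ Ω₁)
    (hS : ContDiffOn ℝ 2 S U) (hfix : S φ = φ) (r : ℝ)
    (hrlim : Tendsto
      (fun n : ℕ => ‖((fderiv ℝ S φ) ^ n : Y →L[ℝ] Y)‖ ^ ((1:ℝ)/n)) atTop (nhds r))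
    (hr : 1 < r) :
    ∃ ε₀ > 0, Metric.closedBall φ ε₀ ⊆ Ω₁ ∧
      ∀ η > 0, ∃ y ∈ Ω₁, ‖y - φ‖ < η ∧ ∃ N : ℕ, 1 ≤ N ∧
        (∀ k < N, ‖S^[k] y - φ‖ < ε₀) ∧ ε₀ ≤ ‖S^[N] y - φ‖ := by
  obtain ⟨M, hM, δ, hδ, hquad⟩ :=
    henry_quadratic S φ (hS.contDiffAt (hU.mem_nhds hφU))
  set L := fderiv ℝ S φ with hLdef
  obtain ⟨ρ, hρ1, hρr⟩ : ∃ ρ, √r < ρ ∧ ρ < r := exists_between (by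
    rw [Real.sqrt_lt' (by linarith)]; nlinarith)
  have hs1 : 1 < √r := by rw [Real.lt_sqrt (by norm_num)]; linarith
  have hρ : 1 < ρ := by linarith
  have hρ2 : r < ρ ^ 2 := (Real.sqrt_lt' (by linarith)).1 hρ1
  obtain ⟨σ, hσr, hσρ⟩ := exists_between hρ2
  obtain ⟨τ, hτρ, hτr⟩ := exists_between hρr
  have hroot : ∀ n : ℕ, n ≠ 0 → (‖L ^ n‖ ^ ((1:ℝ)/n)) ^ n = ‖L ^ n‖ := by
    intro n hn
    rw [one_div]
    exact Real.rpow_inv_natCast_pow (norm_nonneg _) hn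
  -- upper bound
  obtain ⟨K, hK, hL⟩ : ∃ K > 0, ∀ m, ‖L ^ m‖ ≤ K * σ ^ m := by
    have h1 := ((hrlim.eventually (gt_mem_nhds hσr)).and (eventually_ne_atTop 0))
    obtain ⟨n0, hn0⟩ := eventually_atTop.1 h1
    have hs : 0 ≤ ∑ j ∈ Finset.range n0, ‖L ^ j‖ := Finset.sum_nonneg fun _ _ => norm_nonneg _
    refine ⟨1 + ∑ j ∈ Finset.range n0, ‖L ^ j‖, by positivity, fun m => ?_⟩
    have hσm : 1 ≤ σ ^ m := one_le_pow₀ (by linarith)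
    by_cases hm : n0 ≤ m
    · obtain ⟨h2, h3⟩ := hn0 m hm
      have : ‖L ^ m‖ ≤ σ ^ m := by
        rw [← hroot m h3]
        exact pow_le_pow_left₀ (by positivity) h2.le m
      nlinarith
    · have := Finset.single_le_sum (f := fun j => ‖L ^ j‖) (fun _ _ => norm_nonneg _)
        (Finset.mem_range.2 (not_le.1 hm))
      nlinarith
  -- lower bound
  have hlow : ∀ᶠ n : ℕ in atTop, τ ^ n ≤ ‖L ^ n‖ := by
    filter_upwards [hrlim.eventually (lt_mem_nhds hτr), eventually_ne_atTop 0] with n h2 h3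
    rw [← hroot n h3]
    exact pow_le_pow_left₀ (by linarith) h2.le n
  have hnorm : Tendsto (fun n : ℕ => ‖L ^ n‖) atTop atTop :=
    tendsto_atTop_mono' _ hlow (tendsto_pow_atTop_atTop_of_one_lt (by linarith))
  have hratio : Tendsto (fun n : ℕ => ‖L ^ n‖ / ρ ^ n) atTop atTop := by
    refine tendsto_atTop_mono' _ ?_
      (tendsto_pow_atTop_atTop_of_one_lt (r := τ / ρ) ((one_lt_div (by linarith)).2 hτρ))
    filter_upwards [hlow] with n hn
    rw [div_pow]
    gcongr
  obtain ⟨δ', hδ', hball⟩ := Metric.nhds_basis_closedBall.mem_iff.1 (hΩ₁.mem_nhds hφ)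
  have hd : 0 < ρ ^ 2 - σ := by linarith
  obtain ⟨a, ha, ha1, ha2, ha3⟩ : ∃ a > 0, 2 * a ≤ δ ∧ a ≤ δ' ∧
      4 * K * M * a ≤ (ρ ^ 2 - σ) / 4 := by
    refine ⟨min (δ / 2) (min δ' ((ρ ^ 2 - σ) / 4 / (4 * K * M))), by positivity, ?_, ?_, ?_⟩
    · have := min_le_left (δ / 2) (min δ' ((ρ ^ 2 - σ) / 4 / (4 * K * M)))
      linarith
    · exact (min_le_right _ _).trans (min_le_left _ _)
    · have : min (δ / 2) (min δ' ((ρ ^ 2 - σ) / 4 / (4 * K * M))) ≤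
        (ρ ^ 2 - σ) / 4 / (4 * K * M) := (min_le_right _ _).trans (min_le_right _ _)
      rw [le_div_iff₀ (by positivity)] at this
      linarith
  refine ⟨a / 4, by positivity,
    (Metric.closedBall_subset_closedBall (by linarith)).trans hball, fun η hη => ?_⟩
  have hmin : 0 < min η (a / 4) := by positivity
  obtain ⟨n, hrec, hbig⟩ := ((frequently_high_scores hratio).and_eventually
    (hnorm.eventually_gt_atTop (a / min η (a / 4)))).exists
  have hn0 : 0 < ‖L ^ n‖ := lt_trans (by positivity) hbig
  obtain ⟨v, hv1, hv2⟩ := ContinuousLinearMap.exists_lt_apply_of_lt_opNorm (L ^ n)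
    (r := ‖L ^ n‖ / 2) (by linarith)
  set c : ℝ := a / ‖L ^ n‖ with hc
  have hc0 : 0 < c := by positivity
  have hcn : c * ‖L ^ n‖ = a := by rw [hc]; field_simp
  have hcmin : c < min η (a / 4) := by
    rw [hc, div_lt_iff₀ hn0]
    rw [div_lt_iff₀ hmin] at hbig
    linarith
  have hcv : ‖c • v‖ ≤ c := by
    rw [norm_smul, Real.norm_of_nonneg hc0.le]
    nlinarith
  set y := φ + c • v with hy
  have hyφ : y - φ = c • v := by simp [hy]
  have hysmall : ‖y - φ‖ < min η (a / 4) := by rw [hyφ]; linarith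
  have hy1 : ‖y - φ‖ < η := hysmall.trans_le (min_le_left _ _)
  have hy2 : ‖y - φ‖ < a / 4 := hysmall.trans_le (min_le_right _ _)
  have horb := henry_orbit L (fun k => S^[k] y - φ) K σ ρ M δ a n hK (by linarith) hρ hσρ hM ha hL
    (by
      intro j hj
      have := hquad (S^[j] y) hj
      rw [hfix] at this
      simpa only [Function.iterate_succ_apply'] using this) ha1 ha3
    (by
      intro k hk
      have h1 : ‖L ^ k‖ ≤ ‖L ^ n‖ * (ρ ^ k / ρ ^ n) := by
        have h2 : ‖L ^ k‖ / ρ ^ k ≤ ‖L ^ n‖ / ρ ^ n := by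
          rcases hk.lt_or_eq with h | h
          · exact (hrec k h).le
          · rw [h]
        rw [div_le_iff₀ (by positivity)] at h2
        calc _ ≤ _ := h2
          _ = _ := by ring
      have h3 : ‖(L ^ k) (S^[0] y - φ)‖ ≤ ‖L ^ k‖ * c := by
        refine (ContinuousLinearMap.le_opNorm _ _).trans ?_
        simp only [Function.iterate_zero, id, hyφ]
        gcongr
      calc _ ≤ ‖L ^ k‖ * c := h3
        _ ≤ ‖L ^ n‖ * (ρ ^ k / ρ ^ n) * c := by gcongr
        _ = (c * ‖L ^ n‖) * (ρ ^ k / ρ ^ n) := by ring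
        _ = _ := by rw [hcn])
  have hlast : a / 4 ≤ ‖S^[n] y - φ‖ := by
    simp only [Function.iterate_zero, id, hyφ, map_smul] at horb
    have h1 : a / 2 ≤ ‖c • (L ^ n) v‖ := by
      rw [norm_smul, Real.norm_of_nonneg hc0.le]
      nlinarith
    have h2 := norm_sub_norm_le (c • (L ^ n) v) (S^[n] y - φ)
    rw [norm_sub_rev (c • (L ^ n) v)] at h2
    linarith
  have hex : ∃ N, a / 4 ≤ ‖S^[N] y - φ‖ := ⟨n, hlast⟩
  classical
  refine ⟨y, hball ?_, hy1, Nat.find hex, ?_, fun k hk => not_le.1 (Nat.find_min hex hk),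
    Nat.find_spec hex⟩
  · rw [Metric.mem_closedBall, dist_eq_norm]; linarith
  · rw [Nat.one_le_iff_ne_zero]
    intro h0
    have := Nat.find_spec hex
    rw [h0] at this
    simp only [Function.iterate_zero, id] at this
    linarith
end
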